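/- In the change-point setting, for every δ > 0: (i) for each t ∈ (0, τ], sup_{x > δ} | k^{−1} Σ_{i=1}^{[nt]} 1{X_i > x b_pre(n/k)} − t x^{−α_pre} | → 0 in probability and sup_{x > δ} | k^{−1} Σ_{i=1}^{[nt]} (log X_i − log b_pre(n/k) − log x)_+ − t x^{−α_pre} α_pre^{−1} | → 0 in probability; and (ii) for each t ∈ (τ, 1], sup_{x > δ} | k^{−1} Σ_{i=[nτ]+1}^{[nt]} 1{X_i > x b_post(n/k)} − (t − τ) x^{−α_post} | → 0 in probability and sup_{x > δ} | k^{−1} Σ_{i=[nτ]+1}^{[nt]} (log X_i − log b_post(n/k) − log x)_+ − (t − τ) x^{−α_post} α_post^{−1} | → 0 in probability. -/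

import Mathlib

open MeasureTheory ProbabilityTheory Filter Set
open scoped ProbabilityTheory

noncomputable section

namespace TailCusum

variable {Ω : Type*} [MeasureSpace Ω]

/-- `φ₁(x) = 1{x > 0}`. -/
def phi1 (x : ℝ) : ℝ := if 0 < x then 1 else 0

/-- `φ₂(x) = x₊ = max {x, 0}`. -/
def phi2 (x : ℝ) : ℝ := max x 0

/-- positive part -/
def pos (x : ℝ) : ℝ := max x 0

/-- A positive measurable function `g` is regularly varying at `∞` with index `ρ` if
`g(λ x)/g(x) → λ^ρ` as `x → ∞` for every `λ > 0`. -/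
def RegularlyVarying (g : ℝ → ℝ) (ρ : ℝ) : Prop :=
  Measurable g ∧ ∀ lam : ℝ, 0 < lam →
    Tendsto (fun x => g (lam * x) / g x) atTop (nhds (lam ^ ρ))

/-- `l` is slowly varying at `∞`. -/
def SlowlyVarying (l : ℝ → ℝ) : Prop :=
  Measurable l ∧ ∀ lam : ℝ, 0 < lam →
    Tendsto (fun x => l (lam * x) / l x) atTop (nhds 1)

/-- `κ(λ) = K ∫_1^λ t^(γ-1) dt`. -/
def kappaFun (K γ : ℝ) (lam : ℝ) : ℝ := K * ∫ t in (1:ℝ)..lam, t ^ (γ - 1)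

/-- Second-order regular variation condition on the slowly varying function `l`
(the core of condition (A2)): `(l(λx)/l(x) - 1)/g(x) → κ(λ)` with
`κ(λ) = K ∫_1^λ t^(γ-1) dt`, `g` positive and regularly varying with index `γ ≤ 0`. -/
def SecondOrderRV (l g : ℝ → ℝ) (K γ : ℝ) : Prop :=
  γ ≤ 0 ∧ (∀ x, 0 < g x) ∧ RegularlyVarying g γ ∧
  ∀ lam : ℝ, 0 < lam →
    Tendsto (fun x => (l (lam * x) / l x - 1) / g x) atTop (nhds (kappaFun K γ lam))

/-- distribution function of a law on `ℝ` -/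
def df (μ : Measure ℝ) (x : ℝ) : ℝ := (μ (Iic x)).toReal

/-- tail distribution function `F̄(x) = μ(x, ∞)` -/
def tailDF (μ : Measure ℝ) (x : ℝ) : ℝ := (μ (Ioi x)).toReal

/-- the quantile-type function `b(x) = inf {y : F(y) ≥ 1 - x⁻¹}` -/
def quantileB (μ : Measure ℝ) (x : ℝ) : ℝ := sInf {y : ℝ | 1 - x⁻¹ ≤ df μ y}

/-- `F̄(x) = x^(-α) l(x)` for `x > 0` with `l` slowly varying: Pareto-type tail. -/
def ParetoTail (μ : Measure ℝ) (α : ℝ) (l : ℝ → ℝ) : Prop :=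
  SlowlyVarying l ∧ ∀ x : ℝ, 0 < x → tailDF μ x = x ^ (-α) * l x

/-- strict stationarity of a sequence of random variables -/
def IsStationary (X : ℕ → Ω → ℝ) : Prop :=
  ∀ j : ℕ,
    Measure.map (fun ω => fun i : ℕ => X (i + j) ω) (ℙ : Measure Ω)
      = Measure.map (fun ω => fun i : ℕ => X i ω) (ℙ : Measure Ω)

/-- strict stationarity, `ℤ`-indexed -/
def IsStationaryZ (X : ℤ → Ω → ℝ) : Prop :=
  ∀ j : ℤ,
    Measure.map (fun ω => fun i : ℤ => X (i + j) ω) (ℙ : Measure Ω)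
      = Measure.map (fun ω => fun i : ℤ => X i ω) (ℙ : Measure Ω)

/-- The β-mixing coefficient of the sequence `X` at lag `lag`, expressed as
the supremum over `m` of the total-variation distance between the joint law of
`(X_1, …, X_m)` and `(X_{m+lag+1}, X_{m+lag+2}, …)` and the product of the two laws. -/
def betaMix (X : ℕ → Ω → ℝ) (lag : ℕ) : ℝ :=
  ⨆ m : ℕ, ⨆ S : Subtype (MeasurableSet : Set ((Fin m → ℝ) × (ℕ → ℝ)) → Prop),
    |((Measure.map
        (fun ω => ((fun i : Fin m => X ((i : ℕ) + 1) ω, fun i : ℕ => X (m + lag + 1 + i) ω)))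
        (ℙ : Measure Ω)) S.1).toReal
      - (((Measure.map (fun ω => fun i : Fin m => X ((i : ℕ) + 1) ω) (ℙ : Measure Ω)).prod
          (Measure.map (fun ω => fun i : ℕ => X (m + lag + 1 + i) ω) (ℙ : Measure Ω))) S.1).toReal|

/-- The tail sample fraction condition: `k → ∞` and `k = o(n)`. -/
def TailFraction (k : ℕ → ℕ) : Prop :=
  Tendsto (fun n : ℕ => (k n : ℝ)) atTop atTop ∧
    Tendsto (fun n : ℕ => (k n : ℝ) / n) atTop (nhds 0)

/-- Condition (A1): `(n / r_n) β([ε r_n]) → 0` for every `ε > 0`, and `r_n² = o(k)`. -/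
def CondA1 (X : ℕ → Ω → ℝ) (k r : ℕ → ℕ) : Prop :=
  (∀ n, 0 < r n) ∧
  (∀ ε : ℝ, 0 < ε →
    Tendsto (fun n : ℕ => ((n : ℝ) / r n) * betaMix X ⌊ε * r n⌋₊) atTop (nhds 0)) ∧
  Tendsto (fun n : ℕ => ((r n : ℝ) ^ 2 / k n)) atTop (nhds 0)

/-- Condition (A2): second-order regular variation of `l` plus
`√k · g(b(n/k)) → A ∈ ℝ`. -/
def CondA2 (l g : ℝ → ℝ) (K γ A : ℝ) (b : ℝ → ℝ) (k : ℕ → ℕ) : Prop :=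
  SecondOrderRV l g K γ ∧
    Tendsto (fun n : ℕ => Real.sqrt (k n) * g (b ((n : ℝ) / k n))) atTop (nhds A)

/-- covariance of two real random variables -/
def cov (f g : Ω → ℝ) : ℝ :=
  ∫ ω, (f ω - ∫ ω', f ω') * (g ω - ∫ ω', g ω')

/-- pairs `1 ≤ i < j ≤ N` -/
def pairsUpTo (N : ℕ) : Finset (ℕ × ℕ) :=
  ((Finset.Icc 1 N) ×ˢ (Finset.Icc 1 N)).filter fun p => p.1 < p.2

/-- Condition (A3): existence of the limits `χ` and `ω` of the normalized sums of
covariances, for every `0 < ε < 1`. -/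
def CondA3 (X : ℕ → Ω → ℝ) (b : ℝ → ℝ) (k r : ℕ → ℕ) (α χ ωc : ℝ) : Prop :=
  0 ≤ χ ∧ 0 ≤ ωc ∧
  ∀ ε : ℝ, 0 < ε → ε < 1 →
    (Tendsto (fun n : ℕ =>
        (2 * α ^ 2 * n / ((⌊ε * r n⌋₊ : ℝ) * k n)) *
          ∑ p ∈ pairsUpTo ⌊ε * r n⌋₊,
            cov (fun ω => pos (Real.log (X p.1 ω) - Real.log (b ((n : ℝ) / k n))))
                (fun ω => pos (Real.log (X p.2 ω) - Real.log (b ((n : ℝ) / k n)))))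
      atTop (nhds χ)) ∧
    (Tendsto (fun n : ℕ =>
        (2 * (n : ℝ) / ((⌊ε * r n⌋₊ : ℝ) * k n)) *
          ∑ p ∈ pairsUpTo ⌊ε * r n⌋₊,
            cov (fun ω => if b ((n : ℝ) / k n) < X p.1 ω then (1 : ℝ) else 0)
                (fun ω => if b ((n : ℝ) / k n) < X p.2 ω then (1 : ℝ) else 0))
      atTop (nhds ωc))

/-- the `k`-th largest value among `X_1, …, X_n` -/
def orderStat (n k : ℕ) (X : ℕ → Ω → ℝ) (ω : Ω) : ℝ :=
  sInf {x : ℝ | ((Finset.Icc 1 n).filter fun i => x < X i ω).card < k}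

/-- `|Σ_{i=1}^l Y_i - (l/n) Σ_{i=1}^n Y_i|` -/
def cusumAt (n : ℕ) (Y : ℕ → ℝ) (l : ℕ) : ℝ :=
  |∑ i ∈ Finset.Icc 1 l, Y i - ((l : ℝ) / n) * ∑ i ∈ Finset.Icc 1 n, Y i|

/-- The cusum statistic `T_n(φ)` with random threshold `X_(k)`. -/
def cusum (n k : ℕ) (X : ℕ → Ω → ℝ) (φ : ℝ → ℝ) (ω : Ω) : ℝ :=
  (Real.sqrt k)⁻¹ *
    ⨆ l ∈ Finset.Icc 1 n,
      cusumAt n (fun i => φ (Real.log (X i ω) - Real.log (orderStat n k X ω))) l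

/-- The cusum statistic with deterministic threshold `b(n/k)`. -/
def cusumDet (n k : ℕ) (X : ℕ → Ω → ℝ) (φ : ℝ → ℝ) (b : ℝ → ℝ) (ω : Ω) : ℝ :=
  (Real.sqrt k)⁻¹ *
    ⨆ l ∈ Finset.Icc 1 n,
      cusumAt n (fun i => φ (Real.log (X i ω) - Real.log (b ((n : ℝ) / k)))) l

/-- convergence in distribution (weak convergence of laws) of real random variables to
a real random variable `Z` defined on a possibly different probability space -/
def TendstoInDist {Ω' : Type*} [MeasureSpace Ω'] (Y : ℕ → Ω → ℝ) (Z : Ω' → ℝ) : Prop :=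
  ∀ f : ℝ → ℝ, Continuous f → (∃ C, ∀ x, |f x| ≤ C) →
    Tendsto (fun n : ℕ => ∫ ω, f (Y n ω)) atTop (nhds (∫ ω, f (Z ω)))

/-- convergence in distribution to a law `μ` on `ℝ` -/
def TendstoInLaw (Y : ℕ → Ω → ℝ) (μ : Measure ℝ) : Prop :=
  ∀ f : ℝ → ℝ, Continuous f → (∃ C, ∀ x, |f x| ≤ C) →
    Tendsto (fun n : ℕ => ∫ ω, f (Y n ω)) atTop (nhds (∫ x, f x ∂μ))

/-- bounded in probability (`O_P(1)`) -/
def BddInProb (Y : ℕ → Ω → ℝ) : Prop :=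
  ∀ ε : ℝ, 0 < ε → ∃ C : ℝ, ∀ᶠ n in atTop,
    ((ℙ : Measure Ω) {ω | C < |Y n ω|}).toReal < ε

/-- divergence to `+∞` in probability -/
def DivergesInProb (Y : ℕ → Ω → ℝ) : Prop :=
  ∀ C : ℝ, Tendsto (fun n : ℕ => ((ℙ : Measure Ω) {ω | Y n ω ≤ C}).toReal) atTop (nhds 0)

/-- standard Brownian motion on `[0, ∞)` -/
structure IsStdBrownianMotion {Ω' : Type*} [MeasureSpace Ω'] (B : ℝ → Ω' → ℝ) : Prop where
  isProb : IsProbabilityMeasure (ℙ : Measure Ω')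
  meas : ∀ t, Measurable (B t)
  start : ∀ᵐ ω ∂(ℙ : Measure Ω'), B 0 ω = 0
  gauss_incr : ∀ s t : ℝ, 0 ≤ s → s ≤ t →
    Measure.map (fun ω => B t ω - B s ω) (ℙ : Measure Ω')
      = gaussianReal 0 (Real.toNNReal (t - s))
  indep_incr : ∀ (n : ℕ) (ts : ℕ → ℝ), (∀ i, 0 ≤ ts i) → Monotone ts →
    iIndepFun (m := fun _ => Real.measurableSpace)
      (fun i : Fin n => fun ω => B (ts ((i : ℕ) + 1)) ω - B (ts (i : ℕ)) ω)
      (ℙ : Measure Ω')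

/-- `sup_{0 ≤ t ≤ 1} |B°(t)|` where `B°(t) = B(t) - t B(1)` is the Brownian bridge
associated with the Brownian motion `B` -/
def supAbsBrownianBridge {Ω' : Type*} [MeasureSpace Ω'] (B : ℝ → Ω' → ℝ) (ω : Ω') : ℝ :=
  ⨆ t : Icc (0 : ℝ) 1, |B (t : ℝ) ω - (t : ℝ) * B 1 ω|

/-- `A_i(ζ) = φ(log X_i - log b(n/k) + ζ/√k)` -/
def An (X : ℕ → Ω → ℝ) (b : ℝ → ℝ) (φ : ℝ → ℝ) (n k : ℕ) (ζ : ℝ) (i : ℕ) (ω : Ω) : ℝ :=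
  φ (Real.log (X i ω) - Real.log (b ((n : ℝ) / k)) + ζ / Real.sqrt k)

/-- the tail sequential process `M_n(t, ζ) = k^{-1/2} Σ_{i=1}^{[nt]} (A_i(ζ) - E A_1(ζ))` -/
def Mn (X : ℕ → Ω → ℝ) (b : ℝ → ℝ) (φ : ℝ → ℝ) (n k : ℕ) (t ζ : ℝ) (ω : Ω) : ℝ :=
  (Real.sqrt k)⁻¹ * ∑ i ∈ Finset.Icc 1 ⌊(n : ℝ) * t⌋₊,
    (An X b φ n k ζ i ω - ∫ ω', An X b φ n k ζ 1 ω')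

/-- residual `ξ̂_i = X_i - Σ_{j=1}^p φ̂_j X_{i-j}` of an AR(p) fit -/
def residual (p : ℕ) (X : ℤ → Ω → ℝ) (φh : Ω → Fin p → ℝ) (i : ℕ) (ω : Ω) : ℝ :=
  X i ω - ∑ j : Fin p, φh ω j * X ((i : ℤ) - ((j : ℕ) + 1)) ω

/-- absolute residual `Ẑ_i = |ξ̂_i|` -/
def Zhat (p : ℕ) (X : ℤ → Ω → ℝ) (φh : Ω → Fin p → ℝ) (i : ℕ) (ω : Ω) : ℝ :=
  |residual p X φh i ω|

/-- stationarity of the restriction of `Y` to the segment of indices `[a, b]` -/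
def SegStationary (a b : ℕ) (Y : ℕ → Ω → ℝ) : Prop :=
  ∀ (m : ℕ) (s : Fin m → ℕ) (j : ℕ), (∀ q, a ≤ s q ∧ s q + j ≤ b) →
    Measure.map (fun ω => fun q : Fin m => Y (s q + j) ω) (ℙ : Measure Ω)
      = Measure.map (fun ω => fun q : Fin m => Y (s q) ω) (ℙ : Measure Ω)

/-- the row-wise mixing coefficient
`β_n(l) = sup_m sup {|P(A∩B) - P(A)P(B)| : A ∈ σ(Y_i : m+l+1 ≤ i ≤ n), B ∈ σ(Y_1,…,Y_m)}` -/
def betaMixRow (n : ℕ) (Y : ℕ → Ω → ℝ) (lag : ℕ) : ℝ :=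
  ⨆ m : ℕ, ⨆ As : Subtype (MeasurableSet : Set (Fin (n - (m + lag)) → ℝ) → Prop),
    ⨆ Bs : Subtype (MeasurableSet : Set (Fin m → ℝ) → Prop),
      |((ℙ : Measure Ω)
          (((fun ω => fun i : Fin (n - (m + lag)) => Y (m + lag + 1 + (i : ℕ)) ω) ⁻¹' As.1)
            ∩ ((fun ω => fun i : Fin m => Y ((i : ℕ) + 1) ω) ⁻¹' Bs.1))).toReal
        - ((ℙ : Measure Ω)
            ((fun ω => fun i : Fin (n - (m + lag)) => Y (m + lag + 1 + (i : ℕ)) ω) ⁻¹' As.1)).toReal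
          * ((ℙ : Measure Ω)
            ((fun ω => fun i : Fin m => Y ((i : ℕ) + 1) ω) ⁻¹' Bs.1)).toReal|


/-- A `[0,1]`-valued weight inherits bounds on the integral over its superlevel sets. -/
lemma abs_integral_mul_le_of_superlevel {Ω : Type*} [MeasurableSpace Ω] {P : Measure Ω}
    [IsProbabilityMeasure P] {F h : Ω → ℝ} (hF : Measurable F) (hF0 : ∀ ω, 0 ≤ F ω)
    (hF1 : ∀ ω, F ω ≤ 1) (hh : Integrable h P) {c : ℝ}
    (hc : ∀ s : ℝ, |∫ ω in {ω | s < F ω}, h ω ∂P| ≤ c) :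
    |∫ ω, F ω * h ω ∂P| ≤ c := by
  have hlayer : ∀ ω, F ω * h ω
      = ∫ s in Ioc (0:ℝ) 1, {p : Ω × ℝ | p.2 < F p.1}.indicator (fun p => h p.1) (ω, s) := by
    intro ω
    have h1 : (fun s : ℝ => {p : Ω × ℝ | p.2 < F p.1}.indicator (fun p => h p.1) (ω, s))
        = (Iio (F ω)).indicator (fun _ => h ω) := by
      ext s; simp [indicator]
    rw [h1, setIntegral_indicator measurableSet_Iio, setIntegral_const]
    have h2 : Ioc (0:ℝ) 1 ∩ Iio (F ω) = Ioo 0 (F ω) := by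
      ext s
      simp only [mem_inter_iff, mem_Ioc, mem_Iio, mem_Ioo]
      constructor
      · rintro ⟨⟨a, b⟩, c⟩; exact ⟨a, c⟩
      · rintro ⟨a, b⟩; exact ⟨⟨a, by linarith [hF1 ω]⟩, b⟩
    rw [h2]
    simp [Measure.real, Real.volume_Ioo, hF0 ω]
  have hset : MeasurableSet {p : Ω × ℝ | p.2 < F p.1} :=
    measurableSet_lt measurable_snd (hF.comp measurable_fst)
  have hInt : Integrable (Function.uncurry fun ω s =>
      {p : Ω × ℝ | p.2 < F p.1}.indicator (fun p => h p.1) (ω, s))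
      (P.prod (volume.restrict (Ioc (0:ℝ) 1))) := by
    have : Integrable (fun p : Ω × ℝ => h p.1) (P.prod (volume.restrict (Ioc (0:ℝ) 1))) :=
      hh.comp_fst _
    exact this.indicator hset
  simp_rw [hlayer]
  rw [integral_integral_swap hInt]
  have hb : ∀ s ∈ Ioc (0:ℝ) 1,
      ‖∫ ω, {p : Ω × ℝ | p.2 < F p.1}.indicator (fun p => h p.1) (ω, s) ∂P‖ ≤ c := by
    intro s _
    have : (fun ω => {p : Ω × ℝ | p.2 < F p.1}.indicator (fun p => h p.1) (ω, s))
        = {ω | s < F ω}.indicator h := by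
      ext ω; simp [indicator]
    rw [this, integral_indicator (measurableSet_lt measurable_const hF)]
    exact hc s
  have := norm_setIntegral_le_of_norm_le_const (μ := (volume : Measure ℝ)) (s := Ioc (0:ℝ) 1)
    (by simp) hb
  simpa using this

/-- The σ-algebra generated by `Y_1, …, Y_m`. -/
@[reducible]
def pastSigma (Y : ℕ → Ω → ℝ) (m : ℕ) : MeasurableSpace Ω :=
  MeasurableSpace.comap (fun ω => fun i : Fin m => Y ((i : ℕ) + 1) ω) inferInstance

/-- The σ-algebra generated by `Y_{m+lag+1}, …, Y_n`. -/
@[reducible]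
def futureSigma (n : ℕ) (Y : ℕ → Ω → ℝ) (m lag : ℕ) : MeasurableSpace Ω :=
  MeasurableSpace.comap
    (fun ω => fun i : Fin (n - (m + lag)) => Y (m + lag + 1 + (i : ℕ)) ω) inferInstance

lemma measurable_pastSigma {Ω : Type*} (Y : ℕ → Ω → ℝ) {m i : ℕ} (h1 : 1 ≤ i) (h2 : i ≤ m) :
    Measurable[pastSigma Y m] (Y i) := by
  have h : Measurable[pastSigma Y m] (fun ω => fun i : Fin m => Y ((i : ℕ) + 1) ω) :=
    comap_measurable _
  have h3 := (measurable_pi_apply (⟨i - 1, by omega⟩ : Fin m)).comp h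
  have h4 : Y i = (fun f : Fin m → ℝ => f ⟨i - 1, by omega⟩) ∘
      (fun ω => fun i : Fin m => Y ((i : ℕ) + 1) ω) := by
    ext ω
    simp only [Function.comp]
    congr 1
    omega
  rw [h4]; exact h3

lemma measurable_futureSigma {Ω : Type*} (Y : ℕ → Ω → ℝ) {n m lag i : ℕ} (h1 : m + lag < i)
    (h2 : i ≤ n) :
    Measurable[futureSigma n Y m lag] (Y i) := by
  have h : Measurable[futureSigma n Y m lag]
      (fun ω => fun i : Fin (n - (m + lag)) => Y (m + lag + 1 + (i : ℕ)) ω) :=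
    comap_measurable _
  have h3 := (measurable_pi_apply (⟨i - (m + lag + 1), by omega⟩ : Fin (n - (m + lag)))).comp h
  have h4 : Y i = (fun f : Fin (n - (m + lag)) → ℝ => f ⟨i - (m + lag + 1), by omega⟩) ∘
      (fun ω => fun i : Fin (n - (m + lag)) => Y (m + lag + 1 + (i : ℕ)) ω) := by
    ext ω
    simp only [Function.comp]
    congr 1
    omega
  rw [h4]; exact h3

lemma pastSigma_le {Y : ℕ → Ω → ℝ} (hY : ∀ i, Measurable (Y i)) (m : ℕ) :
    pastSigma Y m ≤ MeasureSpace.toMeasurableSpace :=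
  Measurable.comap_le (measurable_pi_lambda _ fun _ => hY _)

lemma futureSigma_le {Y : ℕ → Ω → ℝ} (hY : ∀ i, Measurable (Y i)) (n m lag : ℕ) :
    futureSigma n Y m lag ≤ MeasureSpace.toMeasurableSpace :=
  Measurable.comap_le (measurable_pi_lambda _ fun _ => hY _)

lemma abs_real_inter_sub_le_one [IsProbabilityMeasure (ℙ : Measure Ω)] (A B C : Set Ω) :
    |((ℙ : Measure Ω) A).toReal - ((ℙ : Measure Ω) B).toReal * ((ℙ : Measure Ω) C).toReal|
      ≤ 1 := by
  have h : ∀ S : Set Ω, ((ℙ : Measure Ω) S).toReal ≤ 1 := fun S => measureReal_le_one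
  have h0 : ∀ S : Set Ω, 0 ≤ ((ℙ : Measure Ω) S).toReal := fun S => ENNReal.toReal_nonneg
  have := mul_le_one₀ (h B) (h0 C) (h C)
  have := mul_nonneg (h0 B) (h0 C)
  rw [abs_le]
  constructor <;> linarith [h A, h0 A]

lemma abs_inter_sub_mul_le_betaMixRow [IsProbabilityMeasure (ℙ : Measure Ω)]
    (n : ℕ) (Y : ℕ → Ω → ℝ) (m lag : ℕ) {A B : Set Ω}
    (hA : MeasurableSet[futureSigma n Y m lag] A) (hB : MeasurableSet[pastSigma Y m] B) :
    |((ℙ : Measure Ω) (A ∩ B)).toReal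
      - ((ℙ : Measure Ω) A).toReal * ((ℙ : Measure Ω) B).toReal| ≤ betaMixRow n Y lag := by
  obtain ⟨S, hS, rfl⟩ := hA
  obtain ⟨T, hT, rfl⟩ := hB
  unfold betaMixRow
  refine le_trans ?_ (le_ciSup (f := fun m : ℕ => _) ⟨1, ?_⟩ m)
  · refine le_trans ?_ (le_ciSup (f := fun S : Subtype _ => _) ⟨1, ?_⟩ ⟨S, hS⟩)
    · refine le_trans ?_ (le_ciSup (f := fun S : Subtype _ => _) ⟨1, ?_⟩ ⟨T, hT⟩)
      · exact le_rfl
      · rintro _ ⟨_, rfl⟩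
        exact abs_real_inter_sub_le_one _ _ _
    · rintro _ ⟨_, rfl⟩
      have : Nonempty (Subtype (MeasurableSet : Set (Fin m → ℝ) → Prop)) :=
        ⟨⟨∅, MeasurableSet.empty⟩⟩
      exact ciSup_le fun _ => abs_real_inter_sub_le_one _ _ _
  · rintro _ ⟨m, rfl⟩
    have : Nonempty (Subtype (MeasurableSet : Set (Fin m → ℝ) → Prop)) :=
      ⟨⟨∅, MeasurableSet.empty⟩⟩
    have : Nonempty (Subtype (MeasurableSet : Set (Fin (n - (m + lag)) → ℝ) → Prop)) :=
      ⟨⟨∅, MeasurableSet.empty⟩⟩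
    exact ciSup_le fun _ => ciSup_le fun _ => abs_real_inter_sub_le_one _ _ _

/-- Covariance inequality for `[0,1]`-valued functions of the past and of the future. -/
lemma abs_cov_le_betaMixRow [IsProbabilityMeasure (ℙ : Measure Ω)]
    {n : ℕ} {Y : ℕ → Ω → ℝ} (hY : ∀ i, Measurable (Y i)) {m lag : ℕ} {F G : Ω → ℝ}
    (hF : Measurable[pastSigma Y m] F) (hF0 : ∀ ω, 0 ≤ F ω) (hF1 : ∀ ω, F ω ≤ 1)
    (hG : Measurable[futureSigma n Y m lag] G) (hG0 : ∀ ω, 0 ≤ G ω) (hG1 : ∀ ω, G ω ≤ 1) :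
    |(∫ ω, F ω * G ω) - (∫ ω, F ω) * ∫ ω, G ω| ≤ betaMixRow n Y lag := by
  have hFm : Measurable F := hF.mono (pastSigma_le hY m) le_rfl
  have hGm : Measurable G := hG.mono (futureSigma_le hY n m lag) le_rfl
  have hFi : Integrable F := Integrable.of_bound hFm.aestronglyMeasurable 1
    (ae_of_all _ fun ω => by rw [Real.norm_eq_abs, abs_of_nonneg (hF0 ω)]; exact hF1 ω)
  have hGi : Integrable G := Integrable.of_bound hGm.aestronglyMeasurable 1
    (ae_of_all _ fun ω => by rw [Real.norm_eq_abs, abs_of_nonneg (hG0 ω)]; exact hG1 ω)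
  have hFGi : Integrable (fun ω => G ω * F ω) := Integrable.of_bound
    (hGm.mul hFm).aestronglyMeasurable 1
    (ae_of_all _ fun ω => by
      rw [Real.norm_eq_abs, abs_of_nonneg (mul_nonneg (hG0 ω) (hF0 ω))]
      exact mul_le_one₀ (hG1 ω) (hF0 ω) (hF1 ω))
  have key : |∫ ω, G ω * (F ω - ∫ ω', F ω')| ≤ betaMixRow n Y lag := by
    refine abs_integral_mul_le_of_superlevel hGm hG0 hG1 (hFi.sub (integrable_const _)) ?_
    intro s
    set A := {ω | s < G ω} with hAdef
    have hA : MeasurableSet[futureSigma n Y m lag] A :=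
      hG measurableSet_Ioi
    have hAm : MeasurableSet A := futureSigma_le hY n m lag _ hA
    have e1 : ∫ ω in A, (F ω - ∫ ω', F ω')
        = ∫ ω, F ω * (A.indicator (fun _ => (1:ℝ)) ω - ((ℙ : Measure Ω) A).toReal) := by
      have h1 : Integrable (fun ω => F ω * A.indicator (fun _ => (1:ℝ)) ω) := by
        have := hFi.indicator hAm
        refine this.congr (ae_of_all _ fun ω => ?_)
        by_cases h : ω ∈ A <;> simp [h]
      rw [integral_sub hFi.integrableOn (integrable_const _)]
      simp_rw [mul_sub]
      rw [integral_sub h1 (hFi.mul_const _), integral_mul_const, setIntegral_const]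
      congr 1
      · rw [← integral_indicator hAm]
        refine integral_congr_ae (ae_of_all _ fun ω => ?_)
        by_cases h : ω ∈ A <;> simp [h]
      · simp [Measure.real, mul_comm]
    simp only [Pi.sub_apply]
    rw [e1]
    refine abs_integral_mul_le_of_superlevel hFm hF0 hF1
      (((integrable_const (1:ℝ)).indicator hAm).sub (integrable_const _)) ?_
    intro u
    set B := {ω | u < F ω} with hBdef
    have hB : MeasurableSet[pastSigma Y m] B :=
      hF measurableSet_Ioi
    have hBm : MeasurableSet B := pastSigma_le hY m _ hB
    have e2 : ∫ ω in B, (A.indicator (fun _ => (1:ℝ)) ω - ((ℙ : Measure Ω) A).toReal)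
        = ((ℙ : Measure Ω) (A ∩ B)).toReal
          - ((ℙ : Measure Ω) A).toReal * ((ℙ : Measure Ω) B).toReal := by
      rw [integral_sub ((integrable_const (1:ℝ)).indicator hAm).integrableOn
        (integrable_const _), setIntegral_indicator hAm]
      simp [Measure.real, mul_comm, Set.inter_comm]
    simp only [Pi.sub_apply]
    rw [e2]
    exact abs_inter_sub_mul_le_betaMixRow n Y m lag hA hB
  have e3 : ∫ ω, G ω * (F ω - ∫ ω', F ω')
      = (∫ ω, F ω * G ω) - (∫ ω, F ω) * ∫ ω, G ω := by
    simp_rw [mul_sub]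
    rw [integral_sub hFGi (hGi.mul_const _), integral_mul_const]
    simp_rw [mul_comm]
  rw [← e3]; exact key

/-- The block sum `Σ_{s < i ≤ s + r} φ_i(Y_i)`. -/
def blockSum (φ : ℕ → ℝ → ℝ) (Y : ℕ → Ω → ℝ) (s r : ℕ) (ω : Ω) : ℝ :=
  ∑ i ∈ Finset.Ioc s (s + r), φ i (Y i ω)

lemma measurable_blockSum {φ : ℕ → ℝ → ℝ} (hφ : ∀ i, Measurable (φ i)) {Y : ℕ → Ω → ℝ}
    (hY : ∀ i, Measurable (Y i)) (s r : ℕ) : Measurable (blockSum φ Y s r) :=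
  Finset.measurable_fun_sum _ fun i _ => (hφ i).comp (hY i)

lemma measurable_blockSum_past {Ω : Type*} {φ : ℕ → ℝ → ℝ} (hφ : ∀ i, Measurable (φ i))
    (Y : ℕ → Ω → ℝ) {s r m : ℕ} (h : s + r ≤ m) :
    Measurable[pastSigma Y m] (blockSum φ Y s r) := by
  refine @Finset.measurable_fun_sum _ _ _ _ _ _ (pastSigma Y m) _ _ fun i hi => ?_
  rw [Finset.mem_Ioc] at hi
  exact (hφ i).comp (measurable_pastSigma Y (by omega) (by omega))

lemma measurable_blockSum_future {Ω : Type*} {φ : ℕ → ℝ → ℝ} (hφ : ∀ i, Measurable (φ i))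
    {n : ℕ} (hφn : ∀ i, n < i → φ i = 0) (Y : ℕ → Ω → ℝ) {s r m lag : ℕ} (h : m + lag ≤ s) :
    Measurable[futureSigma n Y m lag] (blockSum φ Y s r) := by
  refine @Finset.measurable_fun_sum _ _ _ _ _ _ (futureSigma n Y m lag) _ _ fun i hi => ?_
  rw [Finset.mem_Ioc] at hi
  by_cases hin : i ≤ n
  · exact (hφ i).comp (measurable_futureSigma Y (by omega) hin)
  · rw [hφn i (by omega)]
    exact measurable_const

lemma blockSum_nonneg {Ω : Type*} {φ : ℕ → ℝ → ℝ} (hφ0 : ∀ i u, 0 ≤ φ i u) (Y : ℕ → Ω → ℝ)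
    (s r : ℕ) (ω : Ω) : 0 ≤ blockSum φ Y s r ω :=
  Finset.sum_nonneg fun i _ => hφ0 i _

lemma blockSum_sq_le {Ω : Type*} (φ : ℕ → ℝ → ℝ) (Y : ℕ → Ω → ℝ) (s r : ℕ) (ω : Ω) :
    blockSum φ Y s r ω ^ 2 ≤ r * ∑ i ∈ Finset.Ioc s (s + r), φ i (Y i ω) ^ 2 := by
  have := sq_sum_le_card_mul_sum_sq (s := Finset.Ioc s (s + r)) (f := fun i => φ i (Y i ω))
  simpa [blockSum] using this

lemma exp_neg_le_quadratic {y : ℝ} (hy : 0 ≤ y) : Real.exp (-y) ≤ 1 - y + y ^ 2 / 2 := by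
  have h := Real.quadratic_le_exp_of_nonneg hy
  have h1 : 0 < 1 + y + y ^ 2 / 2 := by positivity
  rw [Real.exp_neg, inv_le_comm₀ (Real.exp_pos y) (by nlinarith [sq_nonneg (y - 1)])]
  refine le_trans ?_ h
  rw [inv_le_iff_one_le_mul₀ (by nlinarith [sq_nonneg (y - 1)])]
  nlinarith [sq_nonneg (y ^ 2)]

/-- Laplace transforms over blocks separated by gaps of length `r` nearly factorize. -/
lemma abs_integral_prod_blocks_sub_le [IsProbabilityMeasure (ℙ : Measure Ω)]
    {n : ℕ} {Y : ℕ → Ω → ℝ} (hY : ∀ i, Measurable (Y i))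
    {φ : ℕ → ℝ → ℝ} (hφ : ∀ i, Measurable (φ i)) (hφ0 : ∀ i u, 0 ≤ φ i u)
    (hφn : ∀ i, n < i → φ i = 0) {c : ℝ} (hc : 0 ≤ c) (a r J : ℕ) :
    |(∫ ω, ∏ p ∈ Finset.range (J + 1), Real.exp (-(c * blockSum φ Y (a + 2 * p * r) r ω)))
      - ∏ p ∈ Finset.range (J + 1),
          ∫ ω, Real.exp (-(c * blockSum φ Y (a + 2 * p * r) r ω))|
      ≤ J * betaMixRow n Y r := by
  have hF0 : ∀ p ω, 0 ≤ Real.exp (-(c * blockSum φ Y (a + 2 * p * r) r ω)) :=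
    fun p ω => (Real.exp_pos _).le
  have hF1 : ∀ p ω, Real.exp (-(c * blockSum φ Y (a + 2 * p * r) r ω)) ≤ 1 := by
    intro p ω
    rw [Real.exp_le_one_iff]
    have := mul_nonneg hc (blockSum_nonneg hφ0 Y (a + 2 * p * r) r ω)
    linarith
  induction J with
  | zero => simp
  | succ J ih =>
    rw [Finset.prod_range_succ _ (J + 1)]
    simp_rw [Finset.prod_range_succ _ (J + 1)]
    set G := fun ω => Real.exp (-(c * blockSum φ Y (a + 2 * (J + 1) * r) r ω)) with hG
    set F := fun ω => ∏ p ∈ Finset.range (J + 1),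
      Real.exp (-(c * blockSum φ Y (a + 2 * p * r) r ω)) with hF
    have hFm : Measurable[pastSigma Y (a + 2 * J * r + r)] F := by
      refine @Finset.measurable_fun_prod _ _ _ _ _ _ (pastSigma Y (a + 2 * J * r + r)) _ _
        fun p hp => ?_
      rw [Finset.mem_range] at hp
      refine Real.measurable_exp.comp ((measurable_blockSum_past hφ Y ?_).const_mul c).neg
      have : p * r ≤ J * r := Nat.mul_le_mul_right r (by omega)
      nlinarith
    have hGm : Measurable[futureSigma n Y (a + 2 * J * r + r) r] G :=
      Real.measurable_exp.comp ((measurable_blockSum_future hφ hφn Y (by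
        ring_nf; omega)).const_mul c).neg
    have hcov := abs_cov_le_betaMixRow hY hFm
      (fun ω => Finset.prod_nonneg fun p _ => hF0 p ω)
      (fun ω => Finset.prod_le_one (fun p _ => hF0 p ω) fun p _ => hF1 p ω)
      hGm (fun ω => hF0 _ ω) (fun ω => hF1 _ ω)
    have hGle : ∫ ω, G ω ≤ 1 := by
      have : ∫ ω, G ω ≤ ∫ _ : Ω, (1 : ℝ) :=
        integral_mono_of_nonneg (ae_of_all _ fun ω => hF0 _ ω) (integrable_const _)
          (ae_of_all _ fun ω => hF1 _ ω)
      simpa using this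
    have hG0 : 0 ≤ ∫ ω, G ω := integral_nonneg fun ω => hF0 _ ω
    set Q := ∏ p ∈ Finset.range (J + 1),
          ∫ ω, Real.exp (-(c * blockSum φ Y (a + 2 * p * r) r ω)) with hQ
    have hsplit : (∫ ω, F ω * G ω) - Q * ∫ ω, G ω
        = ((∫ ω, F ω * G ω) - (∫ ω, F ω) * ∫ ω, G ω) + ((∫ ω, F ω) - Q) * ∫ ω, G ω := by
      ring
    have h2 : |((∫ ω, F ω) - Q) * ∫ ω, G ω| ≤ J * betaMixRow n Y r := by
      rw [abs_mul, abs_of_nonneg hG0]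
      exact (mul_le_of_le_one_right (abs_nonneg _) hGle).trans ih
    push_cast
    rw [hsplit]
    refine (abs_add_le _ _).trans ?_
    linarith

/-- Second-moment type estimate for the Laplace transforms of normalized sums of separated
blocks. -/
lemma integral_exp_neg_blocks_sq_le [IsProbabilityMeasure (ℙ : Measure Ω)]
    {n : ℕ} {Y : ℕ → Ω → ℝ} (hY : ∀ i, Measurable (Y i))
    {φ : ℕ → ℝ → ℝ} (hφ : ∀ i, Measurable (φ i)) (hφ0 : ∀ i u, 0 ≤ φ i u)
    (hφn : ∀ i, n < i → φ i = 0)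
    (hInt : ∀ i, Integrable (fun ω => φ i (Y i ω)))
    (hInt2 : ∀ i, Integrable (fun ω => φ i (Y i ω) ^ 2)) {κ : ℝ} (hκ : 0 ≤ κ) (a r J : ℕ)
    {D : ℝ} (hD : κ ^ 2 * r * ∑ p ∈ Finset.range (J + 1),
      ∑ i ∈ Finset.Ioc (a + 2 * p * r) (a + 2 * p * r + r), ∫ ω, φ i (Y i ω) ^ 2 ≤ D)
    {W : Ω → ℝ}
    (hW : W = fun ω => κ * ∑ p ∈ Finset.range (J + 1), blockSum φ Y (a + 2 * p * r) r ω) :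
    ∫ ω, (Real.exp (-W ω) - Real.exp (-∫ ω', W ω')) ^ 2
      ≤ Real.exp (2 * D) - 1 + J * betaMixRow n Y r := by
  have hBi : ∀ s, Integrable (blockSum φ Y s r) := fun s =>
    integrable_finsetSum _ fun i _ => hInt i
  have hBm := measurable_blockSum hφ hY
  have hB0 := fun s ω => blockSum_nonneg hφ0 Y s r ω
  have hWi : Integrable W := by
    rw [hW]
    exact (integrable_finsetSum _ fun p _ => hBi _).const_mul κ
  have hW0 : ∀ ω, 0 ≤ W ω := by
    intro ω; rw [hW]
    exact mul_nonneg hκ (Finset.sum_nonneg fun p _ => hB0 _ ω)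
  set w := ∫ ω, W ω with hw
  have hw0 : 0 ≤ w := integral_nonneg hW0
  have hei : ∀ {f : Ω → ℝ}, Measurable f → (∀ ω, 0 ≤ f ω) →
      Integrable (fun ω => Real.exp (-f ω)) := by
    intro f hf hf0
    refine Integrable.of_bound (Real.measurable_exp.comp hf.neg).aestronglyMeasurable 1
      (ae_of_all _ fun ω => ?_)
    rw [Real.norm_eq_abs, abs_of_pos (Real.exp_pos _), Real.exp_le_one_iff]
    linarith [hf0 ω]
  have hWm : Measurable W := by
    rw [hW]
    exact (Finset.measurable_fun_sum _ fun p _ => hBm _ r).const_mul κ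
  have jensen : Real.exp (-w) ≤ ∫ ω, Real.exp (-W ω) := by
    have h := convexOn_exp.map_integral_le (μ := (ℙ : Measure Ω)) (f := fun ω => -W ω)
      Real.continuous_exp.continuousOn isClosed_univ (by simp) hWi.neg (hei hWm hW0)
    rw [integral_neg] at h
    exact h
  have hprod : ∀ ω, Real.exp (-(2 * W ω))
      = ∏ p ∈ Finset.range (J + 1), Real.exp (-(2 * κ * blockSum φ Y (a + 2 * p * r) r ω)) := by
    intro ω
    rw [← Real.exp_sum, hW]
    congr 1
    simp only [Finset.sum_neg_distrib, Finset.mul_sum]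
    congr 1
    exact Finset.sum_congr rfl fun p _ => by ring
  have hblock : ∀ s, ∫ ω, Real.exp (-(2 * κ * blockSum φ Y s r ω))
      ≤ Real.exp (-(2 * κ * ∫ ω, blockSum φ Y s r ω)
        + 2 * (κ ^ 2 * r * ∑ i ∈ Finset.Ioc s (s + r), ∫ ω, φ i (Y i ω) ^ 2)) := by
    intro s
    have hpt : ∀ ω, Real.exp (-(2 * κ * blockSum φ Y s r ω))
        ≤ 1 - 2 * κ * blockSum φ Y s r ω
          + 2 * (κ ^ 2 * r) * ∑ i ∈ Finset.Ioc s (s + r), φ i (Y i ω) ^ 2 := by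
      intro ω
      have h1 := exp_neg_le_quadratic (y := 2 * κ * blockSum φ Y s r ω)
        (mul_nonneg (by positivity) (hB0 s ω))
      have h2 := mul_le_mul_of_nonneg_left (blockSum_sq_le φ Y s r ω) (sq_nonneg κ)
      nlinarith
    have hs2 : Integrable (fun ω => ∑ i ∈ Finset.Ioc s (s + r), φ i (Y i ω) ^ 2) :=
      integrable_finsetSum _ fun i _ => hInt2 i
    have h3 := integral_mono (hei ((hBm s r).const_mul (2 * κ))
      fun ω => mul_nonneg (by positivity) (hB0 s ω))
      (((integrable_const 1).sub ((hBi s).const_mul (2 * κ))).add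
        (hs2.const_mul (2 * (κ ^ 2 * r)))) hpt
    refine h3.trans ?_
    rw [integral_add' ((integrable_const 1).sub ((hBi s).const_mul (2 * κ)))
      (hs2.const_mul (2 * (κ ^ 2 * r))),
      integral_sub' (integrable_const 1) ((hBi s).const_mul (2 * κ)), integral_const_mul,
      integral_const_mul, integral_finsetSum _ fun i _ => hInt2 i]
    simp only [integral_const, probReal_univ, smul_eq_mul, mul_one]
    have h4 := Real.add_one_le_exp (-(2 * κ * ∫ ω, blockSum φ Y s r ω)
        + 2 * (κ ^ 2 * r * ∑ i ∈ Finset.Ioc s (s + r), ∫ ω, φ i (Y i ω) ^ 2))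
    linarith
  have hlap : ∫ ω, Real.exp (-(2 * W ω))
      ≤ Real.exp (-(2 * w) + 2 * D) + J * betaMixRow n Y r := by
    simp_rw [hprod]
    have h1 := (abs_le.mp (abs_integral_prod_blocks_sub_le hY hφ hφ0 hφn
      (c := 2 * κ) (by positivity) a r J)).2
    have h2 : ∏ p ∈ Finset.range (J + 1),
        ∫ ω, Real.exp (-(2 * κ * blockSum φ Y (a + 2 * p * r) r ω))
        ≤ Real.exp (-(2 * w) + 2 * D) := by
      refine (Finset.prod_le_prod (fun p _ => integral_nonneg fun ω => (Real.exp_pos _).le)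
        fun p _ => hblock (a + 2 * p * r)).trans ?_
      rw [← Real.exp_sum, Real.exp_le_exp, Finset.sum_add_distrib, Finset.sum_neg_distrib]
      have hwe : 2 * w = ∑ p ∈ Finset.range (J + 1),
          2 * κ * ∫ ω, blockSum φ Y (a + 2 * p * r) r ω := by
        rw [hw, hW, integral_const_mul, integral_finsetSum _ fun p _ => hBi _,
          ← Finset.mul_sum]
        ring
      rw [← hwe, ← Finset.mul_sum, ← Finset.mul_sum]
      linarith
    linarith
  have hD0 : 0 ≤ D := le_trans (mul_nonneg (by positivity) (Finset.sum_nonneg fun p _ =>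
    Finset.sum_nonneg fun i _ => integral_nonneg fun ω => sq_nonneg _)) hD
  have hexpand : ∀ ω, (Real.exp (-W ω) - Real.exp (-w)) ^ 2
      = Real.exp (-(2 * W ω)) - 2 * Real.exp (-w) * Real.exp (-W ω) + Real.exp (-(2 * w)) := by
    intro ω
    have h1 : Real.exp (-(2 * W ω)) = Real.exp (-W ω) ^ 2 := by
      rw [← Real.exp_nat_mul]; congr 1; push_cast; ring
    have h2 : Real.exp (-(2 * w)) = Real.exp (-w) ^ 2 := by
      rw [← Real.exp_nat_mul]; congr 1; push_cast; ring
    rw [h1, h2]; ring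
  have i1 : Integrable (fun ω => Real.exp (-(2 * W ω))) :=
    hei (hWm.const_mul 2) fun ω => by linarith [hW0 ω]
  have i2 : Integrable (fun ω => 2 * Real.exp (-w) * Real.exp (-W ω)) :=
    (hei hWm hW0).const_mul _
  simp_rw [hexpand]
  have hInt' : ∫ ω, (Real.exp (-(2 * W ω)) - 2 * Real.exp (-w) * Real.exp (-W ω)
      + Real.exp (-(2 * w))) = (∫ ω, Real.exp (-(2 * W ω)))
        - 2 * Real.exp (-w) * (∫ ω, Real.exp (-W ω)) + Real.exp (-(2 * w)) := by
    have i3 : Integrable (fun ω => Real.exp (-(2 * W ω)) - 2 * Real.exp (-w) * Real.exp (-W ω)) :=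
      i1.sub i2
    rw [integral_add i3 (integrable_const _), integral_sub i1 i2, integral_const_mul]
    simp
  rw [hInt']
  have e1 : Real.exp (-w) * Real.exp (-w) = Real.exp (-(2 * w)) := by
    rw [← Real.exp_add]; congr 1; ring
  have e2 : Real.exp (-(2 * w) + 2 * D) = Real.exp (-(2 * w)) * Real.exp (2 * D) :=
    Real.exp_add _ _
  have e3 : Real.exp (-(2 * w)) ≤ 1 := by rw [Real.exp_le_one_iff]; linarith
  have e4 : 1 ≤ Real.exp (2 * D) := Real.one_le_exp (by linarith)
  have e5 := mul_le_mul_of_nonneg_left jensen (Real.exp_pos (-w)).le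
  have e6 := mul_nonneg (sub_nonneg.mpr e3) (sub_nonneg.mpr e4)
  rw [e2] at hlap
  nlinarith

/-- Concentration of a non-negative variable from the concentration of its exponential
transform. -/
lemma real_prob_abs_sub_ge_le {Ω : Type*} [MeasurableSpace Ω] {P : Measure Ω}
    [IsProbabilityMeasure P] {W : Ω → ℝ} (hWm : Measurable W) (hW0 : ∀ ω, 0 ≤ W ω)
    {w C ε q : ℝ} (hw : 0 ≤ w) (hwC : w ≤ C) (hε : 0 < ε)
    (hq : ∫ ω, (Real.exp (-W ω) - Real.exp (-w)) ^ 2 ∂P ≤ q) :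
    P.real {ω | ε ≤ |W ω - w|} ≤ q / (Real.exp (-C) * (1 - Real.exp (-ε))) ^ 2 := by
  set η := Real.exp (-C) * (1 - Real.exp (-ε)) with hη
  have h1 : Real.exp (-ε) < 1 := by rw [Real.exp_lt_one_iff]; linarith
  have hη0 : 0 < η := mul_pos (Real.exp_pos _) (by linarith)
  have hexp : ∀ ω, |Real.exp (-W ω) - Real.exp (-w)| ≤ 1 := by
    intro ω
    have a1 : Real.exp (-W ω) ≤ 1 := by rw [Real.exp_le_one_iff]; linarith [hW0 ω]
    have a2 : Real.exp (-w) ≤ 1 := by rw [Real.exp_le_one_iff]; linarith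
    rw [abs_le]
    constructor <;> linarith [Real.exp_pos (-W ω), Real.exp_pos (-w)]
  have hInt : Integrable (fun ω => (Real.exp (-W ω) - Real.exp (-w)) ^ 2) P := by
    refine Integrable.of_bound
      (((Real.measurable_exp.comp hWm.neg).sub_const _).pow_const 2).aestronglyMeasurable 1
      (ae_of_all _ fun ω => ?_)
    rw [Real.norm_eq_abs, abs_pow]
    exact pow_le_one₀ (abs_nonneg _) (hexp ω)
  have hsub : {ω | ε ≤ |W ω - w|} ⊆ {ω | η ^ 2 ≤ (Real.exp (-W ω) - Real.exp (-w)) ^ 2} := by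
    intro ω hω
    simp only [mem_ofPred_eq] at hω ⊢
    rw [sq_le_sq, abs_of_pos hη0]
    have hCw : Real.exp (-C) ≤ Real.exp (-w) := Real.exp_le_exp.mpr (by linarith)
    rcases le_abs'.mp hω with h | h
    · have e1 : Real.exp (-w) * Real.exp ε ≤ Real.exp (-W ω) := by
        rw [← Real.exp_add, Real.exp_le_exp]; linarith
      have e2 : Real.exp (-ε) + 1 / Real.exp (-ε) ≥ 2 := by
        have := Real.exp_pos (-ε)
        rw [ge_iff_le, ← sub_nonneg]
        have : Real.exp (-ε) + 1 / Real.exp (-ε) - 2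
            = (Real.exp (-ε) - 1) ^ 2 / Real.exp (-ε) := by field_simp; ring
        rw [this]; positivity
      have e3 : 1 / Real.exp (-ε) = Real.exp ε := by rw [Real.exp_neg]; simp
      rw [e3] at e2
      refine le_trans ?_ (le_abs_self _)
      have e4 := mul_le_mul_of_nonneg_right hCw (show 0 ≤ 1 - Real.exp (-ε) by linarith)
      have e5 := mul_le_mul_of_nonneg_left
        (show 1 - Real.exp (-ε) ≤ Real.exp ε - 1 by linarith) (Real.exp_pos (-w)).le
      linarith
    · have e1 : Real.exp (-W ω) ≤ Real.exp (-w) * Real.exp (-ε) := by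
        rw [← Real.exp_add, Real.exp_le_exp]; linarith
      rw [abs_sub_comm]
      refine le_trans ?_ (le_abs_self _)
      have e4 := mul_le_mul_of_nonneg_right hCw (show 0 ≤ 1 - Real.exp (-ε) by linarith)
      linarith
  have hm := mul_meas_ge_le_integral_of_nonneg (μ := P)
    (ae_of_all _ fun ω => sq_nonneg (Real.exp (-W ω) - Real.exp (-w))) hInt (η ^ 2)
  rw [le_div_iff₀ (by positivity)]
  have := measureReal_mono (μ := P) hsub
  nlinarith [sq_nonneg η]

lemma sum_alternating_blocks (f : ℕ → ℝ) (a r J : ℕ) :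
    (∑ p ∈ Finset.range J, ∑ i ∈ Finset.Ioc (a + 2 * p * r) (a + 2 * p * r + r), f i)
      + ∑ p ∈ Finset.range J, ∑ i ∈ Finset.Ioc (a + r + 2 * p * r) (a + r + 2 * p * r + r), f i
      = ∑ i ∈ Finset.Ioc a (a + 2 * J * r), f i := by
  induction J with
  | zero => simp
  | succ J ih =>
    rw [Finset.sum_range_succ, Finset.sum_range_succ]
    have h1 := Finset.sum_Ioc_consecutive f (show a ≤ a + 2 * J * r by omega)
      (show a + 2 * J * r ≤ a + 2 * J * r + r by omega)
    have h2 := Finset.sum_Ioc_consecutive f (show a ≤ a + 2 * J * r + r by omega)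
      (show a + 2 * J * r + r ≤ a + 2 * J * r + r + r by omega)
    have e1 : a + r + 2 * J * r = a + 2 * J * r + r := by ring
    have e2 : a + 2 * (J + 1) * r = a + 2 * J * r + r + r := by ring
    rw [e1, e2, ← h2, ← h1, ← ih]
    ring

/-- Non-asymptotic weak law of large numbers over a stretch of a strongly mixing row. -/
lemma real_prob_abs_row_sum_sub_ge_le [IsProbabilityMeasure (ℙ : Measure Ω)]
    {n : ℕ} {Y : ℕ → Ω → ℝ} (hY : ∀ i, Measurable (Y i)) {a N r : ℕ} (haN : a + N ≤ n)
    (hr : 0 < r) {μ : Measure ℝ}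
    (hμ : ∀ i, a < i → i ≤ a + N → Measure.map (Y i) (ℙ : Measure Ω) = μ)
    {g : ℝ → ℝ} (hg : Measurable g) (hg0 : ∀ u, 0 ≤ g u) (hgi : Integrable g μ)
    (hgi2 : Integrable (fun u => g u ^ 2) μ) {κ C D ε : ℝ} (hκ : 0 ≤ κ) (hε : 0 < ε)
    (hC : κ * (N * ∫ u, g u ∂μ) ≤ C) (hD : κ ^ 2 * r * (N * ∫ u, g u ^ 2 ∂μ) ≤ D) :
    (ℙ : Measure Ω).real {ω | ε ≤ |κ * ∑ i ∈ Finset.Ioc a (a + N), g (Y i ω)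
        - κ * (N * ∫ u, g u ∂μ)|}
      ≤ 2 * ((Real.exp (2 * D) - 1 + (⌊(n : ℝ) / r⌋₊ : ℝ) * betaMixRow n Y r)
        / (Real.exp (-C) * (1 - Real.exp (-(ε / 2)))) ^ 2) := by
  set φ : ℕ → ℝ → ℝ := fun i => if a < i ∧ i ≤ a + N then g else 0 with hφdef
  have hφ : ∀ i, Measurable (φ i) := by
    intro i; by_cases h : a < i ∧ i ≤ a + N
    · simpa [hφdef, h] using hg
    · simp only [hφdef, h, if_false]; exact measurable_const
  have hφ0 : ∀ i u, 0 ≤ φ i u := by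
    intro i u; by_cases h : a < i ∧ i ≤ a + N
    · simpa [hφdef, h] using hg0 u
    · simp [hφdef, h]
  have hφn : ∀ i, n < i → φ i = 0 := by
    intro i hi
    have : ¬ (a < i ∧ i ≤ a + N) := by omega
    simp [hφdef, this]
  have hInt : ∀ i, Integrable (fun ω => φ i (Y i ω)) := by
    intro i; by_cases h : a < i ∧ i ≤ a + N
    · have h1 := hgi
      rw [← hμ i h.1 h.2] at h1
      simpa [hφdef, h, Function.comp_def] using h1.comp_measurable (hY i)
    · simp [hφdef, h]
  have hInt2 : ∀ i, Integrable (fun ω => φ i (Y i ω) ^ 2) := by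
    intro i; by_cases h : a < i ∧ i ≤ a + N
    · have h1 := hgi2
      rw [← hμ i h.1 h.2] at h1
      simpa [hφdef, h, Function.comp_def] using h1.comp_measurable (hY i)
    · simp [hφdef, h]
  set J := ⌊(n : ℝ) / r⌋₊ with hJ
  have hcover : N ≤ 2 * (J + 1) * r := by
    rw [Nat.floor_div_natCast, Nat.floor_natCast] at hJ
    have : n < (J + 1) * r := by
      rw [hJ]; exact Nat.lt_mul_of_div_lt (Nat.lt_succ_self _) hr
    nlinarith
  have hsum : ∀ f : ℕ → ℝ, (∀ i, ¬ (a < i ∧ i ≤ a + N) → f i = 0) →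
      (∑ p ∈ Finset.range (J + 1), ∑ i ∈ Finset.Ioc (a + 2 * p * r) (a + 2 * p * r + r), f i)
      + ∑ p ∈ Finset.range (J + 1),
          ∑ i ∈ Finset.Ioc (a + r + 2 * p * r) (a + r + 2 * p * r + r), f i
      = ∑ i ∈ Finset.Ioc a (a + N), f i := by
    intro f hf
    rw [sum_alternating_blocks]
    symm
    refine Finset.sum_subset (Finset.Ioc_subset_Ioc_right (by omega)) fun i _ hi => hf i ?_
    rwa [Finset.mem_Ioc] at hi
  set W₀ : Ω → ℝ :=
    fun ω => κ * ∑ p ∈ Finset.range (J + 1), blockSum φ Y (a + 2 * p * r) r ω with hW₀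
  set W₁ : Ω → ℝ :=
    fun ω => κ * ∑ p ∈ Finset.range (J + 1), blockSum φ Y (a + r + 2 * p * r) r ω with hW₁
  have hWsum : ∀ ω, W₀ ω + W₁ ω = κ * ∑ i ∈ Finset.Ioc a (a + N), g (Y i ω) := by
    intro ω
    simp only [hW₀, hW₁, ← mul_add, blockSum]
    rw [hsum (fun i => φ i (Y i ω)) fun i hi => by simp [hφdef, hi]]
    congr 1
    refine Finset.sum_congr rfl fun i hi => ?_
    rw [Finset.mem_Ioc] at hi
    simp [hφdef, hi]
  have hE2 : ∀ i, a < i ∧ i ≤ a + N → ∫ ω, φ i (Y i ω) ^ 2 = ∫ u, g u ^ 2 ∂μ := by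
    intro i hi
    rw [← hμ i hi.1 hi.2, integral_map (hY i).aemeasurable
      (hg.pow_const 2).aestronglyMeasurable]
    simp [hφdef, hi]
  have hE1 : ∀ i, a < i ∧ i ≤ a + N → ∫ ω, g (Y i ω) = ∫ u, g u ∂μ := by
    intro i hi
    rw [← hμ i hi.1 hi.2, integral_map (hY i).aemeasurable hg.aestronglyMeasurable]
  have hS2 := hsum (fun i => ∫ ω, φ i (Y i ω) ^ 2) fun i hi => by simp [hφdef, hi]
  have hS2' : ∑ i ∈ Finset.Ioc a (a + N), ∫ ω, φ i (Y i ω) ^ 2 = N * ∫ u, g u ^ 2 ∂μ := by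
    rw [Finset.sum_congr rfl fun i hi => hE2 i (Finset.mem_Ioc.mp hi)]
    simp
  rw [hS2'] at hS2
  have hbl : ∀ s, 0 ≤ ∑ p ∈ Finset.range (J + 1),
      ∑ i ∈ Finset.Ioc (s + 2 * p * r) (s + 2 * p * r + r), ∫ ω, φ i (Y i ω) ^ 2 :=
    fun s => Finset.sum_nonneg fun p _ => Finset.sum_nonneg fun i _ =>
      integral_nonneg fun ω => sq_nonneg _
  have hκr : 0 ≤ κ ^ 2 * r := by positivity
  have q0 := integral_exp_neg_blocks_sq_le hY hφ hφ0 hφn hInt hInt2 hκ a r J (D := D)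
    ((mul_le_mul_of_nonneg_left (by linarith [hbl (a + r)]) hκr).trans hD) hW₀
  have q1 := integral_exp_neg_blocks_sq_le hY hφ hφ0 hφn hInt hInt2 hκ (a + r) r J (D := D)
    ((mul_le_mul_of_nonneg_left (by linarith [hbl a]) hκr).trans hD) hW₁
  have hWm : ∀ s, Measurable
      (fun ω => κ * ∑ p ∈ Finset.range (J + 1), blockSum φ Y (s + 2 * p * r) r ω) := fun s =>
    (Finset.measurable_fun_sum _ fun p _ => measurable_blockSum hφ hY _ r).const_mul κ
  have hWi : ∀ s, Integrable
      (fun ω => κ * ∑ p ∈ Finset.range (J + 1), blockSum φ Y (s + 2 * p * r) r ω) := fun s =>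
    (integrable_finsetSum _ fun p _ => integrable_finsetSum _ fun i _ => hInt i).const_mul κ
  have hWnn : ∀ s ω,
      0 ≤ κ * ∑ p ∈ Finset.range (J + 1), blockSum φ Y (s + 2 * p * r) r ω := fun s ω =>
    mul_nonneg hκ (Finset.sum_nonneg fun p _ => blockSum_nonneg hφ0 Y _ r ω)
  have w0 : 0 ≤ ∫ ω, W₀ ω := integral_nonneg (hWnn a)
  have w1 : 0 ≤ ∫ ω, W₁ ω := integral_nonneg (hWnn (a + r))
  have hmean : (∫ ω, W₀ ω) + ∫ ω, W₁ ω = κ * (N * ∫ u, g u ∂μ) := by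
    refine (integral_add (hWi a) (hWi (a + r))).symm.trans
      ((integral_congr_ae (ae_of_all _ hWsum)).trans ?_)
    rw [integral_const_mul, integral_finsetSum]
    · rw [Finset.sum_congr rfl fun i hi => hE1 i (Finset.mem_Ioc.mp hi)]
      simp
    · intro i hi
      rw [Finset.mem_Ioc] at hi
      simpa [hφdef, hi] using hInt i
  have p0 := real_prob_abs_sub_ge_le (hWm a) (hWnn a) w0 (C := C) (by linarith) (half_pos hε) q0
  have p1 := real_prob_abs_sub_ge_le (hWm (a + r)) (hWnn (a + r)) w1 (C := C) (by linarith)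
    (half_pos hε) q1
  have hsub : {ω | ε ≤ |κ * ∑ i ∈ Finset.Ioc a (a + N), g (Y i ω) - κ * (N * ∫ u, g u ∂μ)|}
      ⊆ {ω | ε / 2 ≤ |W₀ ω - ∫ ω', W₀ ω'|} ∪ {ω | ε / 2 ≤ |W₁ ω - ∫ ω', W₁ ω'|} := by
    intro ω hω
    simp only [mem_ofPred_eq, mem_union] at hω ⊢
    by_contra hcon
    push Not at hcon
    rw [← hWsum, ← hmean, show W₀ ω + W₁ ω - ((∫ ω, W₀ ω) + ∫ ω, W₁ ω)
      = (W₀ ω - ∫ ω, W₀ ω) + (W₁ ω - ∫ ω, W₁ ω) by ring] at hω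
    have := abs_add_le (W₀ ω - ∫ ω, W₀ ω) (W₁ ω - ∫ ω, W₁ ω)
    linarith [hcon.1, hcon.2]
  have h1 := (measureReal_mono (μ := (ℙ : Measure Ω)) hsub).trans (measureReal_union_le _ _)
  linarith

section RegularVariation

variable {μ : Measure ℝ}

lemma tailDF_nonneg (μ : Measure ℝ) (x : ℝ) : 0 ≤ tailDF μ x := ENNReal.toReal_nonneg

lemma tailDF_antitone (μ : Measure ℝ) [IsProbabilityMeasure μ] : Antitone (tailDF μ) :=
  fun _ _ h => ENNReal.toReal_mono (measure_ne_top _ _) (measure_mono (Ioi_subset_Ioi h))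

lemma df_eq_one_sub_tailDF (μ : Measure ℝ) [IsProbabilityMeasure μ] (x : ℝ) :
    df μ x = 1 - tailDF μ x := by
  have h := probReal_compl_eq_one_sub (μ := μ) (measurableSet_Ioi (a := x))
  rw [compl_Ioi] at h
  exact h

/-- The tail of a Pareto-type law is regularly varying. -/
lemma ParetoTail.tendsto_ratio {α : ℝ} {l : ℝ → ℝ} (h : ParetoTail μ α l) {c : ℝ} (hc : 0 < c) :
    Tendsto (fun z => tailDF μ (c * z) / tailDF μ z) atTop (nhds (c ^ (-α))) := by
  have h1 := (h.1.2 c hc).const_mul (c ^ (-α))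
  rw [mul_one] at h1
  refine h1.congr' ?_
  filter_upwards [eventually_gt_atTop 0] with z hz
  rw [h.2 _ (mul_pos hc hz), h.2 _ hz, Real.mul_rpow hc.le hz.le]
  have := (Real.rpow_pos_of_pos hz (-α)).ne'
  field_simp

lemma ParetoTail.tailDF_pos [IsProbabilityMeasure μ] {α : ℝ} {l : ℝ → ℝ}
    (h : ParetoTail μ α l) (x : ℝ) : 0 < tailDF μ x := by
  have h1 := h.tendsto_ratio one_pos
  rw [Real.one_rpow] at h1
  obtain ⟨z, hz, hxz⟩ := ((h1.eventually (lt_mem_nhds zero_lt_one)).and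
    (eventually_ge_atTop x)).exists
  have : 0 < tailDF μ z := by
    refine lt_of_le_of_ne (tailDF_nonneg μ z) fun h0 => ?_
    rw [← h0, div_zero] at hz
    exact lt_irrefl _ hz
  exact this.trans_le (tailDF_antitone μ hxz)

lemma quantileB_nonneg [IsProbabilityMeasure μ] (hμ : μ (Iio 0) = 0) {y : ℝ} (hy : 1 < y) :
    (∀ z ∈ {z : ℝ | 1 - y⁻¹ ≤ df μ z}, 0 ≤ z) ∧ {z : ℝ | 1 - y⁻¹ ≤ df μ z}.Nonempty := by
  have hy1 : y⁻¹ < 1 := inv_lt_one_of_one_lt₀ hy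
  constructor
  · intro z hz
    by_contra hneg
    push Not at hneg
    have h0 : μ (Iic z) = 0 :=
      measure_mono_null (fun u (hu : u ≤ z) => lt_of_le_of_lt hu hneg) hμ
    simp only [mem_ofPred_eq, df, h0, ENNReal.toReal_zero] at hz
    linarith
  · have h1 : Tendsto (fun z => (μ (Iic z)).toReal) atTop (nhds (μ univ).toReal) :=
      (ENNReal.tendsto_toReal (measure_ne_top _ _)).comp (tendsto_measure_Iic_atTop μ)
    rw [measure_univ, ENNReal.toReal_one] at h1
    obtain ⟨z, hz⟩ := (h1.eventually (lt_mem_nhds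
      (show 1 - y⁻¹ < 1 by have : 0 < y⁻¹ := by positivity
                           linarith))).exists
    exact ⟨z, hz.le⟩

lemma tailDF_le_of_quantileB_lt [IsProbabilityMeasure μ] (hμ : μ (Iio 0) = 0) {y z : ℝ}
    (hy : 1 < y) (hz : quantileB μ y < z) : tailDF μ z ≤ y⁻¹ := by
  obtain ⟨v, hv, hvz⟩ := exists_lt_of_csInf_lt (quantileB_nonneg hμ hy).2 hz
  have h1 : 1 - y⁻¹ ≤ df μ v := hv
  rw [df_eq_one_sub_tailDF] at h1
  linarith [tailDF_antitone μ hvz.le]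

lemma le_tailDF_of_lt_quantileB [IsProbabilityMeasure μ] (hμ : μ (Iio 0) = 0) {y z : ℝ}
    (hy : 1 < y) (hz : z < quantileB μ y) : y⁻¹ ≤ tailDF μ z := by
  have h1 : ¬ (1 - y⁻¹ ≤ df μ z) := fun h =>
    notMem_of_lt_csInf hz ⟨0, (quantileB_nonneg hμ hy).1⟩ h
  rw [df_eq_one_sub_tailDF] at h1
  linarith

lemma ParetoTail.tendsto_quantileB [IsProbabilityMeasure μ] (hμ : μ (Iio 0) = 0) {α : ℝ}
    {l : ℝ → ℝ} (h : ParetoTail μ α l) : Tendsto (quantileB μ) atTop atTop := by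
  rw [tendsto_atTop]
  intro z
  have hp := h.tailDF_pos z
  filter_upwards [eventually_gt_atTop 1, eventually_gt_atTop (tailDF μ z)⁻¹] with y hy hyz
  refine le_csInf (quantileB_nonneg hμ hy).2 fun v hv => ?_
  by_contra hvz
  push Not at hvz
  have h1 : 1 - y⁻¹ ≤ df μ v := hv
  rw [df_eq_one_sub_tailDF] at h1
  have h2 := tailDF_antitone μ hvz.le
  have h3 : y⁻¹ < tailDF μ z := inv_lt_of_inv_lt₀ hp hyz
  linarith

lemma ParetoTail.tendsto_mul_tailDF [IsProbabilityMeasure μ] (hμ : μ (Iio 0) = 0) {α : ℝ}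
    {l : ℝ → ℝ} (h : ParetoTail μ α l) {x : ℝ} (hx : 0 < x) :
    Tendsto (fun y => y * tailDF μ (x * quantileB μ y)) atTop (nhds (x ^ (-α))) := by
  have hb := h.tendsto_quantileB hμ
  have hcont : Tendsto (fun c : ℝ => (x / c) ^ (-α)) (nhds 1) (nhds (x ^ (-α))) := by
    have : ContinuousAt (fun c : ℝ => (x / c) ^ (-α)) 1 :=
      (continuousAt_const.div continuousAt_id one_ne_zero).rpow_const
        (Or.inl (by simpa using hx.ne'))
    have h2 := this.tendsto
    simpa only [div_one] using h2
  have hratio : ∀ c : ℝ, 0 < c → Tendsto (fun y => tailDF μ (x * quantileB μ y)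
      / tailDF μ (c * quantileB μ y)) atTop (nhds ((x / c) ^ (-α))) := by
    intro c hc
    have h1 := (h.tendsto_ratio (div_pos hx hc)).comp (hb.const_mul_atTop hc)
    refine h1.congr fun y => ?_
    simp only [Function.comp]
    congr 2
    field_simp
  rw [tendsto_order]
  constructor
  · intro v hv
    have h1 := (hcont.eventually (lt_mem_nhds hv)).filter_mono
      (nhdsWithin_le_nhds (s := Iio 1))
    obtain ⟨c, hc, hc1, hc0⟩ := (h1.and ((eventually_mem_nhdsWithin (a := (1:ℝ))).and
      ((lt_mem_nhds zero_lt_one).filter_mono nhdsWithin_le_nhds))).exists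
    filter_upwards [(hratio c hc0).eventually (lt_mem_nhds hc), eventually_gt_atTop 1,
      hb.eventually_gt_atTop 0] with y hy hy1 hby
    refine hy.trans_le ?_
    have h2 : y⁻¹ ≤ tailDF μ (c * quantileB μ y) :=
      le_tailDF_of_lt_quantileB hμ hy1 (mul_lt_of_lt_one_left hby hc1)
    rw [div_eq_mul_inv, mul_comm]
    exact mul_le_mul_of_nonneg_right (inv_le_of_inv_le₀ (by linarith) h2) (tailDF_nonneg μ _)
  · intro v hv
    have h1 := (hcont.eventually (gt_mem_nhds hv)).filter_mono
      (nhdsWithin_le_nhds (s := Ioi 1))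
    obtain ⟨c, hc, hc1⟩ := (h1.and (eventually_mem_nhdsWithin (a := (1:ℝ)))).exists
    have hc1' : 1 < c := hc1
    filter_upwards [(hratio c (by linarith)).eventually (gt_mem_nhds hc), eventually_gt_atTop 1,
      hb.eventually_gt_atTop 0] with y hy hy1 hby
    refine lt_of_le_of_lt ?_ hy
    have h2 : tailDF μ (c * quantileB μ y) ≤ y⁻¹ :=
      tailDF_le_of_quantileB_lt hμ hy1 (lt_mul_of_one_lt_left hby hc1)
    rw [div_eq_mul_inv, mul_comm]
    exact mul_le_mul_of_nonneg_left (le_inv_of_le_inv₀ (h.tailDF_pos _) h2) (tailDF_nonneg μ _)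

/-- A Potter-type bound for Pareto-type tails. -/
lemma ParetoTail.exists_potter_bound [IsProbabilityMeasure μ] {α : ℝ} (hα : 0 < α)
    {l : ℝ → ℝ} (h : ParetoTail μ α l) :
    ∃ z₀ : ℝ, 1 ≤ z₀ ∧ ∀ z, z₀ ≤ z → ∀ s : ℝ, 0 ≤ s →
      tailDF μ (z * Real.exp s) ≤ Real.exp (α / 2) * Real.exp (-(α / 2) * s) * tailDF μ z := by
  have h1 := h.tendsto_ratio (Real.exp_pos 1)
  have hlt : Real.exp 1 ^ (-α) < Real.exp (-(α / 2)) := by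
    rw [← Real.exp_mul, Real.exp_lt_exp]; linarith
  obtain ⟨z₁, hz₁⟩ := eventually_atTop.mp (h1.eventually (gt_mem_nhds hlt))
  refine ⟨max z₁ 1, le_max_right _ _, fun z hz s hs => ?_⟩
  have hz0 : 0 < z := by linarith [le_max_right z₁ 1]
  have hpow : ∀ j : ℕ, tailDF μ (z * Real.exp j) ≤ Real.exp (-(α / 2) * j) * tailDF μ z := by
    intro j
    induction j with
    | zero => simp
    | succ j ih =>
      have hzj : z₁ ≤ z * Real.exp j := by
        have : 1 ≤ Real.exp (j : ℝ) := Real.one_le_exp (by positivity)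
        nlinarith [le_max_left z₁ 1]
      have h2 := hz₁ _ hzj
      rw [div_lt_iff₀ (h.tailDF_pos _)] at h2
      have e1 : z * Real.exp ((j + 1 : ℕ) : ℝ) = Real.exp 1 * (z * Real.exp j) := by
        push_cast; rw [Real.exp_add]; ring
      have e2 : Real.exp (-(α / 2) * ((j + 1 : ℕ) : ℝ))
          = Real.exp (-(α / 2)) * Real.exp (-(α / 2) * j) := by
        rw [← Real.exp_add]; congr 1; push_cast; ring
      rw [e1, e2, mul_assoc]
      exact h2.le.trans (mul_le_mul_of_nonneg_left ih (Real.exp_pos _).le)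
  refine (tailDF_antitone μ (mul_le_mul_of_nonneg_left
    (Real.exp_le_exp.mpr (Nat.floor_le hs)) hz0.le)).trans ((hpow ⌊s⌋₊).trans ?_)
  refine mul_le_mul_of_nonneg_right ?_ (tailDF_nonneg μ z)
  rw [← Real.exp_add, Real.exp_le_exp]
  nlinarith [Nat.lt_floor_add_one s]

end RegularVariation

section LogExcess

variable {μ : Measure ℝ}

/-- The log-excess `(log u - log z)₊` of `u` over the level `z`. -/
def logExcess (z u : ℝ) : ℝ := pos (Real.log u - Real.log z)

lemma logExcess_nonneg (z u : ℝ) : 0 ≤ logExcess z u := le_max_right _ _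

lemma measurable_logExcess (z : ℝ) : Measurable (logExcess z) :=
  (Real.measurable_log.sub_const _).max measurable_const

lemma lt_logExcess_iff {z s u : ℝ} (hz : 1 ≤ z) (hs : 0 ≤ s) (hu : 0 ≤ u) :
    s < logExcess z u ↔ z * Real.exp s < u := by
  have hz0 : 0 < z := by linarith
  have h1 : s < logExcess z u ↔ s < Real.log u - Real.log z := by
    unfold logExcess pos
    rw [lt_max_iff]
    exact or_iff_left (not_lt.mpr hs)
  rw [h1]
  rcases hu.eq_or_lt with rfl | hu
  · rw [Real.log_zero]
    have h2 := Real.log_nonneg hz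
    have h3 : 0 < z * Real.exp s := mul_pos hz0 (Real.exp_pos s)
    constructor <;> intro h <;> linarith
  · rw [← Real.log_lt_log_iff (mul_pos hz0 (Real.exp_pos s)) hu,
      Real.log_mul hz0.ne' (Real.exp_pos s).ne', Real.log_exp, lt_sub_iff_add_lt']

lemma measure_lt_logExcess (hμ : μ (Iio 0) = 0) {z s : ℝ} (hz : 1 ≤ z) (hs : 0 ≤ s) :
    μ {u | s < logExcess z u} = μ (Ioi (z * Real.exp s)) := by
  refine measure_congr ?_
  have h0 : ∀ᵐ u ∂μ, ¬ u < 0 := by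
    rw [ae_iff]
    exact measure_mono_null (fun u hu => not_not.mp hu) hμ
  filter_upwards [h0] with u hu
  exact propext (lt_logExcess_iff hz hs (not_lt.mp hu))

/-- Second moment of the log-excess over a high level. -/
lemma ParetoTail.exists_integral_logExcess_sq_le [IsProbabilityMeasure μ] (hμ : μ (Iio 0) = 0)
    {α : ℝ} (hα : 0 < α) {l : ℝ → ℝ} (h : ParetoTail μ α l) :
    ∃ z₀ M : ℝ, 1 ≤ z₀ ∧ ∀ z, z₀ ≤ z → Integrable (fun u => logExcess z u ^ 2) μ ∧
      ∫ u, logExcess z u ^ 2 ∂μ ≤ M * tailDF μ z := by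
  obtain ⟨z₀, hz₀, hP⟩ := h.exists_potter_bound hα
  have hA : IntegrableOn (fun s : ℝ => s * Real.exp (-(α / 2) * s)) (Ioi 0) := by
    have := integrableOn_rpow_mul_exp_neg_mul_rpow (p := 1) (s := 1) (b := α / 2)
      (by norm_num) one_pos (by positivity)
    simpa only [Real.rpow_one] using this
  have hA0 : 0 ≤ ∫ s in Ioi (0 : ℝ), s * Real.exp (-(α / 2) * s) :=
    setIntegral_nonneg measurableSet_Ioi fun s hs => mul_nonneg (le_of_lt hs) (Real.exp_pos _).le
  set A := ∫ s in Ioi (0 : ℝ), s * Real.exp (-(α / 2) * s)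
  refine ⟨z₀, 2 * (Real.exp (α / 2) * A), hz₀, fun z hz => ?_⟩
  have hz1 : 1 ≤ z := hz₀.trans hz
  have ht := tailDF_nonneg μ z
  have hle : ∫⁻ u, ENNReal.ofReal (logExcess z u ^ 2) ∂μ
      ≤ ENNReal.ofReal (2 * (Real.exp (α / 2) * A) * tailDF μ z) := by
    have h1 := lintegral_rpow_eq_lintegral_meas_lt_mul μ
      (ae_of_all _ (logExcess_nonneg z)) (measurable_logExcess z).aemeasurable (p := 2) two_pos
    simp only [Real.rpow_two] at h1
    rw [h1]
    have h2 : ∫⁻ t in Ioi (0 : ℝ), μ {u | t < logExcess z u} * ENNReal.ofReal (t ^ ((2:ℝ) - 1))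
        ≤ ∫⁻ t in Ioi (0 : ℝ), ENNReal.ofReal (Real.exp (α / 2) * tailDF μ z
            * (t * Real.exp (-(α / 2) * t))) := by
      refine setLIntegral_mono' measurableSet_Ioi fun t ht0 => ?_
      have ht0' : 0 ≤ t := le_of_lt ht0
      rw [measure_lt_logExcess hμ hz1 ht0', show ((2:ℝ) - 1) = 1 by norm_num, Real.rpow_one,
        ← ENNReal.ofReal_toReal (measure_ne_top μ (Ioi (z * Real.exp t))),
        ← ENNReal.ofReal_mul ENNReal.toReal_nonneg]
      refine ENNReal.ofReal_le_ofReal ?_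
      have := mul_le_mul_of_nonneg_right (hP z hz t ht0') ht0'
      calc _ ≤ _ := this
        _ = _ := by ring
    rw [← ofReal_integral_eq_lintegral_ofReal (hA.const_mul _)
      ((ae_restrict_iff' measurableSet_Ioi).mpr (ae_of_all _ fun s hs =>
        mul_nonneg (mul_nonneg (Real.exp_pos _).le ht)
          (mul_nonneg (le_of_lt hs) (Real.exp_pos _).le))), integral_const_mul] at h2
    calc _ ≤ ENNReal.ofReal 2 * ENNReal.ofReal (Real.exp (α / 2) * tailDF μ z * A) := by gcongr
      _ = _ := by rw [← ENNReal.ofReal_mul two_pos.le]; congr 1; ring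
  have hmeas : AEStronglyMeasurable (fun u => logExcess z u ^ 2) μ :=
    ((measurable_logExcess z).pow_const 2).aestronglyMeasurable
  refine ⟨⟨hmeas, ?_⟩, ?_⟩
  · rw [hasFiniteIntegral_iff_ofReal (ae_of_all _ fun u => sq_nonneg _)]
    exact hle.trans_lt ENNReal.ofReal_lt_top
  · rw [integral_eq_lintegral_of_nonneg_ae (ae_of_all _ fun u => sq_nonneg _) hmeas]
    exact ENNReal.toReal_le_of_le_ofReal (by positivity) hle

lemma integrable_logExcess_of_sq [IsFiniteMeasure μ] {z : ℝ}
    (h : Integrable (fun u => logExcess z u ^ 2) μ) : Integrable (logExcess z) μ := by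
  refine ((integrable_const (1 : ℝ)).add h).mono' (measurable_logExcess z).aestronglyMeasurable
    (ae_of_all _ fun u => ?_)
  rw [Real.norm_of_nonneg (logExcess_nonneg z u), Pi.add_apply]
  nlinarith [sq_nonneg (logExcess z u - 1)]

/-- The normalized expected log-excess over `x b(y)` converges to `x^(-α) / α`. -/
lemma ParetoTail.tendsto_mul_integral_logExcess [IsProbabilityMeasure μ] (hμ : μ (Iio 0) = 0)
    {α : ℝ} (hα : 0 < α) {l : ℝ → ℝ} (h : ParetoTail μ α l) {x : ℝ} (hx : 0 < x) :
    Tendsto (fun y => y * ∫ u, logExcess (x * quantileB μ y) u ∂μ) atTop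
      (nhds (x ^ (-α) * α⁻¹)) := by
  obtain ⟨z₀, hz₀, hP⟩ := h.exists_potter_bound hα
  obtain ⟨z₁, M, -, hM⟩ := h.exists_integral_logExcess_sq_le hμ hα
  have hb : Tendsto (fun y => x * quantileB μ y) atTop atTop :=
    (h.tendsto_quantileB hμ).const_mul_atTop hx
  have hlim : ∫ s in Ioi (0 : ℝ), x ^ (-α) * Real.exp (-α * s) = x ^ (-α) * α⁻¹ := by
    rw [integral_const_mul, integral_exp_mul_Ioi (by linarith)]
    simp [neg_div_neg_eq]
  rw [← hlim]
  have hdct : Tendsto (fun y => ∫ s in Ioi (0 : ℝ),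
      y * tailDF μ (x * quantileB μ y * Real.exp s)) atTop
      (nhds (∫ s in Ioi (0 : ℝ), x ^ (-α) * Real.exp (-α * s))) := by
    refine tendsto_integral_filter_of_dominated_convergence
      (fun s => (x ^ (-α) + 1) * Real.exp (α / 2) * Real.exp (-(α / 2) * s)) ?_ ?_ ?_ ?_
    · refine Eventually.of_forall fun y => Measurable.aestronglyMeasurable ?_
      exact ((tailDF_antitone μ).measurable.comp
        (Real.measurable_exp.const_mul (x * quantileB μ y))).const_mul y
    · filter_upwards [hb.eventually_ge_atTop z₀, eventually_gt_atTop 0,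
        (h.tendsto_mul_tailDF hμ hx).eventually (gt_mem_nhds (lt_add_one _))] with y hy hy0 hy1
      refine (ae_restrict_iff' measurableSet_Ioi).mpr (ae_of_all _ fun s hs => ?_)
      rw [Real.norm_of_nonneg (mul_nonneg hy0.le (tailDF_nonneg μ _))]
      calc y * tailDF μ (x * quantileB μ y * Real.exp s)
          ≤ y * (Real.exp (α / 2) * Real.exp (-(α / 2) * s) * tailDF μ (x * quantileB μ y)) :=
            mul_le_mul_of_nonneg_left (hP _ hy s (le_of_lt hs)) hy0.le
        _ = (y * tailDF μ (x * quantileB μ y)) * (Real.exp (α / 2) * Real.exp (-(α / 2) * s)) := by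
            ring
        _ ≤ (x ^ (-α) + 1) * (Real.exp (α / 2) * Real.exp (-(α / 2) * s)) :=
            mul_le_mul_of_nonneg_right hy1.le (by positivity)
        _ = _ := by ring
    · exact (integrableOn_exp_mul_Ioi (by linarith) 0).const_mul _
    · refine ae_of_all _ fun s => ?_
      have h1 := h.tendsto_mul_tailDF hμ (mul_pos hx (Real.exp_pos s))
      rw [Real.mul_rpow hx.le (Real.exp_pos s).le, ← Real.exp_mul,
        show s * -α = -α * s by ring] at h1
      refine h1.congr fun y => ?_
      congr 2
      ring
  refine hdct.congr' ?_
  filter_upwards [hb.eventually_ge_atTop z₁, hb.eventually_ge_atTop 1] with y hy hy1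
  rw [(integrable_logExcess_of_sq (hM _ hy).1).integral_eq_integral_meas_lt
    (ae_of_all _ (logExcess_nonneg _)), integral_const_mul]
  congr 1
  refine setIntegral_congr_fun measurableSet_Ioi fun s hs => ?_
  simp only [Measure.real, measure_lt_logExcess hμ hy1 (le_of_lt hs), tailDF]

end LogExcess

/-- Weak law of large numbers for row sums of non-negative functions of a row-wise mixing array. -/
lemma tendsto_real_prob_row_sum [IsProbabilityMeasure (ℙ : Measure Ω)]
    {X : ℕ → ℕ → Ω → ℝ} (hX : ∀ n i, Measurable (X n i)) {a N : ℕ → ℕ}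
    (haN : ∀ n, a n + N n ≤ n) {μ : Measure ℝ}
    (hμ : ∀ n i, a n < i → i ≤ a n + N n → Measure.map (X n i) (ℙ : Measure Ω) = μ)
    {θ : ℝ} (hN : Tendsto (fun n => (N n : ℝ) / n) atTop (nhds θ))
    {k r : ℕ → ℕ} (hr : ∀ n, 0 < r n)
    (hmix : Tendsto (fun n : ℕ => (⌊(n : ℝ) / r n⌋₊ : ℝ) * betaMixRow n (X n) (r n))
      atTop (nhds 0))
    (hrk : Tendsto (fun n : ℕ => (r n : ℝ) / k n) atTop (nhds 0))
    {g : ℕ → ℝ → ℝ} (hg : ∀ n, Measurable (g n)) (hg0 : ∀ n u, 0 ≤ g n u)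
    (hgi : ∀ᶠ n in atTop, Integrable (g n) μ)
    (hgi2 : ∀ᶠ n in atTop, Integrable (fun u => g n u ^ 2) μ)
    {L M : ℝ} (hL : Tendsto (fun n : ℕ => (n : ℝ) / k n * ∫ u, g n u ∂μ) atTop (nhds L))
    (hM : ∀ᶠ n : ℕ in atTop, (n : ℝ) / k n * ∫ u, g n u ^ 2 ∂μ ≤ M) {ε : ℝ} (hε : 0 < ε) :
    Tendsto (fun n => (ℙ : Measure Ω).real {ω | ε ≤
      |(k n : ℝ)⁻¹ * ∑ i ∈ Finset.Ioc (a n) (a n + N n), g n (X n i ω) - θ * L|})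
      atTop (nhds 0) := by
  set D : ℕ → ℝ := fun n => (r n : ℝ) / k n * ((N n : ℝ) / n) * M with hDdef
  have hD : Tendsto D atTop (nhds 0) := by
    simpa using (hrk.mul hN).mul_const M
  set C : ℝ := θ * L + 1
  have hmean : Tendsto (fun n : ℕ => (k n : ℝ)⁻¹ * (N n * ∫ u, g n u ∂μ)) atTop
      (nhds (θ * L)) := by
    refine (hN.mul hL).congr' ?_
    filter_upwards [eventually_gt_atTop 0] with n hn
    have : (n : ℝ) ≠ 0 := by positivity
    field_simp
  set B : ℕ → ℝ := fun n => 2 * ((Real.exp (2 * D n) - 1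
    + (⌊(n : ℝ) / r n⌋₊ : ℝ) * betaMixRow n (X n) (r n))
      / (Real.exp (-C) * (1 - Real.exp (-(ε / 2 / 2)))) ^ 2) with hBdef
  have hB : Tendsto B atTop (nhds 0) := by
    have h1 := (((((Real.continuous_exp.tendsto _).comp (hD.const_mul 2)).sub_const 1).add
      hmix).div_const ((Real.exp (-C) * (1 - Real.exp (-(ε / 2 / 2)))) ^ 2)).const_mul 2
    simpa using h1
  refine tendsto_of_tendsto_of_tendsto_of_le_of_le' tendsto_const_nhds hB
    (Eventually.of_forall fun n => measureReal_nonneg) ?_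
  filter_upwards [hgi, hgi2, hM, eventually_gt_atTop 0,
    hmean.eventually (gt_mem_nhds (show θ * L < C from lt_add_one _)),
    hmean.eventually (Metric.ball_mem_nhds _ (half_pos hε))] with n h1 h2 h3 hn h4 h5
  have hn0 : (n : ℝ) ≠ 0 := by positivity
  have h5' : |(k n : ℝ)⁻¹ * (N n * ∫ u, g n u ∂μ) - θ * L| < ε / 2 := h5
  refine le_trans (measureReal_mono fun ω hω => ?_)
    (real_prob_abs_row_sum_sub_ge_le (hX n) (haN n) (hr n) (hμ n) (hg n) (hg0 n) h1 h2
      (inv_nonneg.mpr (Nat.cast_nonneg _)) (half_pos hε) h4.le (D := D n) ?_)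
  · simp only [mem_ofPred_eq] at hω ⊢
    have := abs_sub_le ((k n : ℝ)⁻¹ * ∑ i ∈ Finset.Ioc (a n) (a n + N n), g n (X n i ω))
      ((k n : ℝ)⁻¹ * (N n * ∫ u, g n u ∂μ)) (θ * L)
    linarith
  · calc (k n : ℝ)⁻¹ ^ 2 * r n * (N n * ∫ u, g n u ^ 2 ∂μ)
        = (r n : ℝ) / k n * ((N n : ℝ) / n) * ((n : ℝ) / k n * ∫ u, g n u ^ 2 ∂μ) := by
          field_simp
      _ ≤ D n := mul_le_mul_of_nonneg_left h3 (by positivity)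

/-- A finite grid controls the uniform distance on `(δ, ∞)` between a non-negative antitone
function and a power function vanishing at infinity. -/
lemma exists_grid_abs_sub_le {c α δ η : ℝ} (hc : 0 ≤ c) (hα : 0 < α) (hδ : 0 < δ) (hη : 0 < η) :
    ∃ S : Finset ℝ, (∀ p ∈ S, 0 < p) ∧ ∀ g : ℝ → ℝ, (∀ x, 0 ≤ g x) → AntitoneOn g (Ioi 0) →
      (∀ p ∈ S, |g p - c * p ^ (-α)| < η) → ∀ x, δ < x → |g x - c * x ^ (-α)| ≤ 2 * η := by
  have hLanti : ∀ x y : ℝ, 0 < x → x ≤ y → c * y ^ (-α) ≤ c * x ^ (-α) := fun x y hx hxy =>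
    mul_le_mul_of_nonneg_left (Real.rpow_le_rpow_of_nonpos hx hxy (by linarith)) hc
  have hL0 : ∀ x : ℝ, 0 < x → 0 ≤ c * x ^ (-α) := fun x hx =>
    mul_nonneg hc (Real.rpow_nonneg hx.le _)
  obtain ⟨ρ, hρ, hρ1⟩ : ∃ ρ : ℝ, c * δ ^ (-α) * (1 - ρ ^ (-α)) < η ∧ 1 < ρ := by
    have hcont : ContinuousAt (fun ρ : ℝ => c * δ ^ (-α) * (1 - ρ ^ (-α))) 1 :=
      continuousAt_const.mul (continuousAt_const.sub
        (continuousAt_id.rpow_const (Or.inl one_ne_zero)))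
    have h1 := hcont.tendsto
    simp only [Real.one_rpow, sub_self, mul_zero] at h1
    have h2 := (h1.eventually (gt_mem_nhds hη)).filter_mono (nhdsWithin_le_nhds (s := Ioi 1))
    exact (h2.and (eventually_mem_nhdsWithin (a := (1:ℝ)))).exists
  obtain ⟨K, hK⟩ : ∃ K : ℕ, c * (δ * ρ ^ K) ^ (-α) < η := by
    have h1 := ((tendsto_rpow_neg_atTop hα).comp
      ((tendsto_pow_atTop_atTop_of_one_lt hρ1).const_mul_atTop hδ)).const_mul c
    rw [mul_zero] at h1
    exact (h1.eventually (gt_mem_nhds hη)).exists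
  have hp0 : ∀ j : ℕ, 0 < δ * ρ ^ j := fun j => by positivity
  refine ⟨(Finset.range (K + 1)).image fun j => δ * ρ ^ j, fun p hp => ?_,
    fun g hg0 hg hS x hx => ?_⟩
  · obtain ⟨j, -, rfl⟩ := Finset.mem_image.mp hp
    exact hp0 j
  have hS' : ∀ j ≤ K, |g (δ * ρ ^ j) - c * (δ * ρ ^ j) ^ (-α)| < η := fun j hj =>
    hS _ (Finset.mem_image_of_mem _ (Finset.mem_range.mpr (Nat.lt_succ_of_le hj)))
  have hx0 : 0 < x := hδ.trans hx
  rcases le_or_gt (δ * ρ ^ K) x with hKx | hKx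
  · have h1 := abs_lt.mp (hS' K le_rfl)
    have h2 := hg (hp0 K) hx0 hKx
    have h3 := hLanti _ _ (hp0 K) hKx
    have h4 := hL0 x hx0
    have h5 := hg0 x
    rw [abs_le]
    constructor <;> linarith
  · obtain ⟨j, hj1, hj2⟩ := exists_nat_pow_near (x := x / δ) (y := ρ)
      ((one_le_div hδ).mpr hx.le) hρ1
    rw [le_div_iff₀' hδ] at hj1
    rw [div_lt_iff₀' hδ] at hj2
    have hjK : j < K := by
      by_contra hcon
      have : δ * ρ ^ K ≤ δ * ρ ^ j :=
        mul_le_mul_of_nonneg_left (pow_le_pow_right₀ hρ1.le (not_lt.mp hcon)) hδ.le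
      linarith
    have h1 := abs_lt.mp (hS' j hjK.le)
    have h2 := abs_lt.mp (hS' (j + 1) hjK)
    have h3 := hg (hp0 j) hx0 hj1
    have h4 := hg hx0 (hp0 (j + 1)) hj2.le
    have h5 := hLanti _ _ (hp0 j) hj1
    have h6 := hLanti _ _ hx0 hj2.le
    have h7 : c * (δ * ρ ^ j) ^ (-α) - c * (δ * ρ ^ (j + 1)) ^ (-α) < η := by
      have hρ0 : 0 < ρ := by linarith
      have e : δ * ρ ^ (j + 1) = (δ * ρ ^ j) * ρ := by ring
      have h8 : c * (δ * ρ ^ j) ^ (-α) ≤ c * δ ^ (-α) :=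
        hLanti _ _ hδ (le_mul_of_one_le_right hδ.le (one_le_pow₀ hρ1.le))
      have h9 : 0 ≤ 1 - ρ ^ (-α) :=
        sub_nonneg.mpr (Real.rpow_le_one_of_one_le_of_nonpos hρ1.le (by linarith))
      rw [e, Real.mul_rpow (hp0 j).le hρ0.le]
      nlinarith [mul_le_mul_of_nonneg_right h8 h9]
    rw [abs_le]
    constructor <;> linarith

/-- Pointwise convergence in probability of antitone processes to a power function is uniform
on `(δ, ∞)`. -/
lemma tendstoInMeasure_iSup_of_antitoneOn [IsProbabilityMeasure (ℙ : Measure Ω)]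
    {G : ℕ → Ω → ℝ → ℝ} {c α δ : ℝ} (hc : 0 ≤ c) (hα : 0 < α) (hδ : 0 < δ)
    (hG0 : ∀ n ω x, 0 ≤ G n ω x) (hG : ∀ᶠ n in atTop, ∀ ω, AntitoneOn (G n ω) (Ioi 0))
    (hlim : ∀ x : ℝ, 0 < x → ∀ ε : ℝ, 0 < ε → Tendsto (fun n => (ℙ : Measure Ω).real
      {ω | ε ≤ |G n ω x - c * x ^ (-α)|}) atTop (nhds 0)) :
    TendstoInMeasure (ℙ : Measure Ω)
      (fun n ω => ⨆ x : Ioi δ, |G n ω x - c * (x : ℝ) ^ (-α)|) atTop 0 := by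
  rw [tendstoInMeasure_iff_measureReal_norm]
  intro ε hε
  obtain ⟨S, hS0, hS⟩ := exists_grid_abs_sub_le hc hα hδ (show 0 < ε / 3 by positivity)
  have hsum : Tendsto (fun n => ∑ p ∈ S, (ℙ : Measure Ω).real
      {ω | ε / 3 ≤ |G n ω p - c * p ^ (-α)|}) atTop (nhds 0) := by
    have := tendsto_finsetSum S fun p hp => hlim p (hS0 p hp) (ε / 3) (by positivity)
    simpa using this
  refine tendsto_of_tendsto_of_tendsto_of_le_of_le' tendsto_const_nhds hsum
    (Eventually.of_forall fun n => measureReal_nonneg) ?_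
  filter_upwards [hG] with n hn
  refine le_trans (measureReal_mono (fun ω hω => ?_) (measure_ne_top _ _))
    (measureReal_biUnion_finset_le S _)
  by_contra hcon
  simp only [mem_iUnion, mem_ofPred_eq, not_exists, not_le] at hcon
  have hsup : ⨆ x : Ioi δ, |G n ω x - c * (x : ℝ) ^ (-α)| ≤ 2 * (ε / 3) := by
    have : Nonempty (Ioi δ) := ⟨⟨δ + 1, lt_add_one δ⟩⟩
    exact ciSup_le fun x => hS (G n ω) (hG0 n ω) (hn ω) hcon x x.2
  have hnn : 0 ≤ ⨆ x : Ioi δ, |G n ω x - c * (x : ℝ) ^ (-α)| :=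
    Real.iSup_nonneg fun x => abs_nonneg _
  simp only [mem_ofPred_eq, Pi.zero_apply, sub_zero, Real.norm_of_nonneg hnn] at hω
  linarith

lemma TailFraction.tendsto_div {k : ℕ → ℕ} (hk : TailFraction k) :
    Tendsto (fun n : ℕ => (n : ℝ) / k n) atTop atTop := by
  have h1 : Tendsto (fun n : ℕ => (k n : ℝ) / n) atTop (nhdsWithin 0 (Ioi 0)) := by
    refine tendsto_nhdsWithin_iff.mpr ⟨hk.2, ?_⟩
    filter_upwards [hk.1.eventually_gt_atTop 0, eventually_gt_atTop 0] with n h1 h2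
    exact div_pos h1 (by positivity)
  refine h1.inv_tendsto_nhdsGT_zero.congr fun n => ?_
  simp

/-- Uniform laws of large numbers for the tail empirical processes over a segment of a row-wise
mixing array with a common Pareto-type marginal on that segment. -/
lemma tail_empirical_ulln_segment [IsProbabilityMeasure (ℙ : Measure Ω)]
    {X : ℕ → ℕ → Ω → ℝ} (hX : ∀ n i, Measurable (X n i)) (hX0 : ∀ n i ω, 0 ≤ X n i ω)
    {a N : ℕ → ℕ} (haN : ∀ n, a n + N n ≤ n) {μ : Measure ℝ}
    (hμ : ∀ n i, a n < i → i ≤ a n + N n → Measure.map (X n i) (ℙ : Measure Ω) = μ)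
    {θ : ℝ} (hθ : 0 < θ) (hN : Tendsto (fun n => (N n : ℝ) / n) atTop (nhds θ))
    {α : ℝ} (hα : 0 < α) {l : ℝ → ℝ} (hF : ParetoTail μ α l)
    {k r : ℕ → ℕ} (hk : TailFraction k) (hr : ∀ n, 0 < r n)
    (hmix : Tendsto (fun n : ℕ => (⌊(n : ℝ) / r n⌋₊ : ℝ) * betaMixRow n (X n) (r n))
      atTop (nhds 0))
    (hrk : Tendsto (fun n : ℕ => (r n : ℝ) / k n) atTop (nhds 0)) {δ : ℝ} (hδ : 0 < δ) :
    TendstoInMeasure (ℙ : Measure Ω)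
      (fun n ω => ⨆ x : Ioi δ, |(k n : ℝ)⁻¹ * ∑ i ∈ Finset.Ioc (a n) (a n + N n),
          (if (x : ℝ) * quantileB μ ((n : ℝ) / k n) < X n i ω then (1 : ℝ) else 0)
        - θ * (x : ℝ) ^ (-α)|) atTop 0 ∧
    TendstoInMeasure (ℙ : Measure Ω)
      (fun n ω => ⨆ x : Ioi δ, |(k n : ℝ)⁻¹ * ∑ i ∈ Finset.Ioc (a n) (a n + N n),
          pos (Real.log (X n i ω) - Real.log (quantileB μ ((n : ℝ) / k n)) - Real.log (x : ℝ))
        - θ * (x : ℝ) ^ (-α) * α⁻¹|) atTop 0 := by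
  obtain ⟨n, hn⟩ := (hN.eventually (lt_mem_nhds hθ)).exists
  have hNn : 0 < N n := Nat.pos_of_ne_zero fun h0 => by simp [h0] at hn
  have hmap := hμ n (a n + 1) (by omega) (by omega)
  have hprob : IsProbabilityMeasure μ :=
    hmap ▸ Measure.isProbabilityMeasure_map (hX n (a n + 1)).aemeasurable
  have hμ0 : μ (Iio 0) = 0 := by
    rw [← hmap, Measure.map_apply (hX n _) measurableSet_Iio]
    refine measure_mono_null (t := ∅) (fun ω hω => ?_) measure_empty
    exact absurd (hX0 n _ ω) (not_le.mpr hω)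
  have hy := hk.tendsto_div
  have hb := (hF.tendsto_quantileB hμ0).comp hy
  have hbpos := hb.eventually_gt_atTop 0
  have htail : ∀ x : ℝ, 0 < x → Tendsto (fun n : ℕ => (n : ℝ) / k n
      * tailDF μ (x * quantileB μ ((n : ℝ) / k n))) atTop (nhds (x ^ (-α))) := fun x hx =>
    (hF.tendsto_mul_tailDF hμ0 hx).comp hy
  constructor
  · refine tendstoInMeasure_iSup_of_antitoneOn
      (G := fun n ω x => (k n : ℝ)⁻¹ * ∑ i ∈ Finset.Ioc (a n) (a n + N n),
        (if x * quantileB μ ((n : ℝ) / k n) < X n i ω then (1 : ℝ) else 0)) hθ.le hα hδ ?_ ?_ ?_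
    · intro n ω x
      exact mul_nonneg (by positivity) (Finset.sum_nonneg fun i _ => by split_ifs <;> norm_num)
    · filter_upwards [hbpos] with n hbn ω x _ y _ hxy
      refine mul_le_mul_of_nonneg_left (Finset.sum_le_sum fun i _ => ?_) (by positivity)
      have h1 : x * quantileB μ ((n : ℝ) / k n) ≤ y * quantileB μ ((n : ℝ) / k n) :=
        mul_le_mul_of_nonneg_right hxy (le_of_lt hbn)
      split_ifs with h2 h3
      · exact le_rfl
      · exact absurd (h1.trans_lt h2) h3
      · exact zero_le_one
      · exact le_rfl
    · intro x hx ε hε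
      set g : ℕ → ℝ → ℝ := fun n =>
        (Ioi (x * quantileB μ ((n : ℝ) / k n))).indicator 1 with hg
      have hgapp : ∀ n u, g n u = if x * quantileB μ ((n : ℝ) / k n) < u then 1 else 0 :=
        fun n u => by simp [hg, indicator_apply]
      have hsq : ∀ n u, g n u ^ 2 = g n u := fun n u => by rw [hgapp]; split_ifs <;> norm_num
      have hgi : ∀ n, Integrable (g n) μ := fun n =>
        (integrable_const (1 : ℝ)).indicator measurableSet_Ioi
      have hInt : ∀ n, ∫ u, g n u ∂μ = tailDF μ (x * quantileB μ ((n : ℝ) / k n)) := fun n =>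
        integral_indicator_one measurableSet_Ioi
      have hmean : Tendsto (fun n : ℕ => (n : ℝ) / k n * ∫ u, g n u ∂μ) atTop
          (nhds (x ^ (-α))) := by
        simpa only [hInt] using htail x hx
      have key := tendsto_real_prob_row_sum hX haN hμ hN hr hmix hrk (g := g)
        (fun n => measurable_const.indicator measurableSet_Ioi)
        (fun n u => indicator_nonneg (fun _ _ => zero_le_one) u)
        (Eventually.of_forall hgi)
        (Eventually.of_forall fun n => by simpa only [hsq] using hgi n) hmean
        (M := x ^ (-α) + 1)
        ((hmean.eventually (gt_mem_nhds (lt_add_one _))).mono fun n hn => by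
          simpa only [hsq] using hn.le) hε
      simpa only [hgapp] using key
  · have hrw : ∀ x : ℝ, θ * x ^ (-α) * α⁻¹ = θ * α⁻¹ * x ^ (-α) := fun x => by ring
    simp only [hrw]
    refine tendstoInMeasure_iSup_of_antitoneOn
      (G := fun n ω x => (k n : ℝ)⁻¹ * ∑ i ∈ Finset.Ioc (a n) (a n + N n),
        pos (Real.log (X n i ω) - Real.log (quantileB μ ((n : ℝ) / k n)) - Real.log x))
      (by positivity) hα hδ ?_ ?_ ?_
    · intro n ω x
      exact mul_nonneg (by positivity) (Finset.sum_nonneg fun i _ => le_max_right _ _)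
    · refine Eventually.of_forall fun n ω x hx y _ hxy => ?_
      refine mul_le_mul_of_nonneg_left (Finset.sum_le_sum fun i _ => ?_) (by positivity)
      exact max_le_max_right 0 (sub_le_sub_left (Real.log_le_log hx hxy) _)
    · intro x hx ε hε
      obtain ⟨z₀, M, -, hM⟩ := hF.exists_integral_logExcess_sq_le hμ0 hα
      have hlarge : ∀ᶠ n : ℕ in atTop, z₀ ≤ x * quantileB μ ((n : ℝ) / k n) :=
        (hb.const_mul_atTop hx).eventually_ge_atTop z₀
      have hbound := ((htail x hx).const_mul M).eventually (gt_mem_nhds (lt_add_one _))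
      have key := tendsto_real_prob_row_sum hX haN hμ hN hr hmix hrk
        (g := fun n => logExcess (x * quantileB μ ((n : ℝ) / k n)))
        (fun n => measurable_logExcess _) (fun n u => logExcess_nonneg _ u)
        (hlarge.mono fun n hn => integrable_logExcess_of_sq (hM _ hn).1)
        (hlarge.mono fun n hn => (hM _ hn).1)
        ((hF.tendsto_mul_integral_logExcess hμ0 hα hx).comp hy)
        (M := M * x ^ (-α) + 1)
        (by
          filter_upwards [hlarge, hbound] with n h1 h2
          refine le_trans (mul_le_mul_of_nonneg_left (hM _ h1).2 (by positivity)) ?_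
          rw [mul_left_comm]
          exact h2.le) hε
      refine key.congr' ?_
      filter_upwards [hbpos] with n hbn
      have hbn' : quantileB μ ((n : ℝ) / k n) ≠ 0 := ne_of_gt hbn
      have e1 : ∀ u, logExcess (x * quantileB μ ((n : ℝ) / k n)) u
          = pos (Real.log u - Real.log (quantileB μ ((n : ℝ) / k n)) - Real.log x) := fun u => by
        rw [logExcess, Real.log_mul hx.ne' hbn', sub_sub, add_comm (Real.log x)]
      have e2 : θ * (x ^ (-α) * α⁻¹) = θ * α⁻¹ * x ^ (-α) := by ring
      simp only [e1, e2]

lemma tendsto_floor_mul_div {t : ℝ} (ht : 0 ≤ t) :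
    Tendsto (fun n : ℕ => (⌊(n : ℝ) * t⌋₊ : ℝ) / n) atTop (nhds t) := by
  have h := (tendsto_nat_floor_mul_div_atTop ht).comp (tendsto_natCast_atTop_atTop (R := ℝ))
  refine h.congr fun n => ?_
  simp only [Function.comp, mul_comm t]

/-- Lemma 10 of Kim–Lee (2009): uniform laws of large numbers for the tail empirical
processes before and after the change point. -/
theorem tail_empirical_ulln_change_point
    {Ω : Type*} [MeasureSpace Ω] [IsProbabilityMeasure (ℙ : Measure Ω)]
    (X : ℕ → ℕ → Ω → ℝ) (hmeas : ∀ n i, Measurable (X n i)) (hpos : ∀ n i ω, 0 ≤ X n i ω)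
    (τ : ℝ) (hτ0 : 0 < τ) (hτ1 : τ < 1)
    (μpre μpost : Measure ℝ)
    (hmargpre : ∀ (n i : ℕ), 1 ≤ i → i ≤ ⌊(n : ℝ) * τ⌋₊ →
      Measure.map (X n i) (ℙ : Measure Ω) = μpre)
    (hmargpost : ∀ (n i : ℕ), ⌊(n : ℝ) * τ⌋₊ < i → i ≤ n →
      Measure.map (X n i) (ℙ : Measure Ω) = μpost)
    (hstatpre : ∀ n : ℕ, SegStationary 1 ⌊(n : ℝ) * τ⌋₊ (X n))
    (hstatpost : ∀ n : ℕ, SegStationary (⌊(n : ℝ) * τ⌋₊ + 1) n (X n))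
    (αpre αpost : ℝ) (hαpre : 0 < αpre) (hαpost : 0 < αpost)
    (lpre lpost : ℝ → ℝ)
    (hFpre : ParetoTail μpre αpre lpre) (hFpost : ParetoTail μpost αpost lpost)
    (k r : ℕ → ℕ) (hk : TailFraction k) (hr : ∀ n, 0 < r n)
    (hmix : Tendsto (fun n : ℕ => (⌊(n : ℝ) / r n⌋₊ : ℝ) * betaMixRow n (X n) (r n))
      atTop (nhds 0))
    (hrk : Tendsto (fun n : ℕ => (r n : ℝ) / k n) atTop (nhds 0)) :
    ∀ δ : ℝ, 0 < δ →
      (∀ t : ℝ, 0 < t → t ≤ τ →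
        (TendstoInMeasure (ℙ : Measure Ω)
          (fun n ω => ⨆ x : Ioi δ,
            |(k n : ℝ)⁻¹ * ∑ i ∈ Finset.Icc 1 ⌊(n : ℝ) * t⌋₊,
                (if (x : ℝ) * quantileB μpre ((n : ℝ) / k n) < X n i ω then (1 : ℝ) else 0)
              - t * (x : ℝ) ^ (-αpre)|)
          atTop 0) ∧
        (TendstoInMeasure (ℙ : Measure Ω)
          (fun n ω => ⨆ x : Ioi δ,
            |(k n : ℝ)⁻¹ * ∑ i ∈ Finset.Icc 1 ⌊(n : ℝ) * t⌋₊,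
                pos (Real.log (X n i ω) - Real.log (quantileB μpre ((n : ℝ) / k n))
                  - Real.log (x : ℝ))
              - t * (x : ℝ) ^ (-αpre) * αpre⁻¹|)
          atTop 0)) ∧
      (∀ t : ℝ, τ < t → t ≤ 1 →
        (TendstoInMeasure (ℙ : Measure Ω)
          (fun n ω => ⨆ x : Ioi δ,
            |(k n : ℝ)⁻¹ * ∑ i ∈ Finset.Icc (⌊(n : ℝ) * τ⌋₊ + 1) ⌊(n : ℝ) * t⌋₊,
                (if (x : ℝ) * quantileB μpost ((n : ℝ) / k n) < X n i ω then (1 : ℝ) else 0)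
              - (t - τ) * (x : ℝ) ^ (-αpost)|)
          atTop 0) ∧
        (TendstoInMeasure (ℙ : Measure Ω)
          (fun n ω => ⨆ x : Ioi δ,
            |(k n : ℝ)⁻¹ * ∑ i ∈ Finset.Icc (⌊(n : ℝ) * τ⌋₊ + 1) ⌊(n : ℝ) * t⌋₊,
                pos (Real.log (X n i ω) - Real.log (quantileB μpost ((n : ℝ) / k n))
                  - Real.log (x : ℝ))
              - (t - τ) * (x : ℝ) ^ (-αpost) * αpost⁻¹|)
          atTop 0)) := by
  intro δ hδ
  have hfloor : ∀ (n : ℕ) {s t : ℝ}, s ≤ t → ⌊(n : ℝ) * s⌋₊ ≤ ⌊(n : ℝ) * t⌋₊ := fun n s t hst =>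
    Nat.floor_mono (mul_le_mul_of_nonneg_left hst n.cast_nonneg)
  have hfloor1 : ∀ (n : ℕ) {t : ℝ}, t ≤ 1 → ⌊(n : ℝ) * t⌋₊ ≤ n := fun n t ht => by
    simpa using hfloor n ht
  refine ⟨fun t ht htτ => ?_, fun t ht ht1 => ?_⟩
  · have key := tail_empirical_ulln_segment hmeas hpos (a := fun _ => 0)
      (N := fun n => ⌊(n : ℝ) * t⌋₊) (fun n => by simpa using hfloor1 n (htτ.trans hτ1.le))
      (fun n i h1 h2 => hmargpre n i h1
        (h2.trans ((Nat.zero_add _).le.trans (hfloor n htτ))))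
      ht (tendsto_floor_mul_div ht.le) hαpre hFpre hk hr hmix hrk hδ
    have hset : ∀ n : ℕ, Finset.Icc 1 ⌊(n : ℝ) * t⌋₊
        = Finset.Ioc 0 (0 + ⌊(n : ℝ) * t⌋₊) := fun n => by
      ext i
      simp only [Finset.mem_Icc, Finset.mem_Ioc]
      omega
    simpa only [hset] using key
  · have hadd : ∀ n : ℕ, ⌊(n : ℝ) * τ⌋₊ + (⌊(n : ℝ) * t⌋₊ - ⌊(n : ℝ) * τ⌋₊)
        = ⌊(n : ℝ) * t⌋₊ := fun n => Nat.add_sub_of_le (hfloor n ht.le)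
    have hlim : Tendsto (fun n : ℕ => ((⌊(n : ℝ) * t⌋₊ - ⌊(n : ℝ) * τ⌋₊ : ℕ) : ℝ) / n) atTop
        (nhds (t - τ)) := by
      refine ((tendsto_floor_mul_div (hτ0.trans ht).le).sub
        (tendsto_floor_mul_div hτ0.le)).congr fun n => ?_
      rw [Nat.cast_sub (hfloor n ht.le), sub_div]
    have key := tail_empirical_ulln_segment hmeas hpos (a := fun n => ⌊(n : ℝ) * τ⌋₊)
      (N := fun n => ⌊(n : ℝ) * t⌋₊ - ⌊(n : ℝ) * τ⌋₊)
      (fun n => (hadd n).le.trans (hfloor1 n ht1))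
      (fun n i h1 h2 => hmargpost n i h1 (h2.trans ((hadd n).le.trans (hfloor1 n ht1))))
      (sub_pos.mpr ht) hlim hαpost hFpost hk hr hmix hrk hδ
    have hset : ∀ n : ℕ, Finset.Icc (⌊(n : ℝ) * τ⌋₊ + 1) ⌊(n : ℝ) * t⌋₊
        = Finset.Ioc ⌊(n : ℝ) * τ⌋₊ (⌊(n : ℝ) * τ⌋₊ + (⌊(n : ℝ) * t⌋₊ - ⌊(n : ℝ) * τ⌋₊)) :=
      fun n => by
        rw [hadd n]
        ext i
        simp only [Finset.mem_Icc, Finset.mem_Ioc]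
        omega
    simpa only [hset] using key

end TailCusum
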